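/- arXiv:chao-dyn/9705010 — 3 statements merged into one kernel-verified Lean document; each statement's English description precedes it below -/
import Mathlib

section
/- Existence of a centre manifold: there exist δ > 0 and a C¹ function h : ℝ^m → ℝ^s with h(0) = 0 and Dh(0) = 0 whose graph is locally invariant under the flow; that is, whenever (x(t), y(t)) is a differentiable solution of the system on an interval I with |x(t)| < δ and |y(t)| < δ for all t ∈ I and y(t₀) = h(x(t₀)) for some t₀ ∈ I, then y(t) = h(x(t)) for all t ∈ I. -/
open Matrix Polynomial

namespace CentreManifold

open Set Filter Topology

theorem exp_add_smul {𝔸 : Type*} [NormedRing 𝔸] [NormedAlgebra ℝ 𝔸] [CompleteSpace 𝔸]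
    (A : 𝔸) (s t : ℝ) :
    NormedSpace.exp ((s + t) • A) = NormedSpace.exp (s • A) * NormedSpace.exp (t • A) := by
  let _ : NormedAlgebra ℚ 𝔸 := NormedAlgebra.restrictScalars ℚ ℝ 𝔸
  rw [add_smul, NormedSpace.exp_add_of_commute]
  exact ((Commute.refl A).smul_left s).smul_right t

section GeneralizedEigenvectors

variable {V : Type*} [NormedAddCommGroup V] [NormedSpace ℂ V] [CompleteSpace V]

theorem exists_norm_exp_apply_le_of_pow_apply_eq_zero (T : V →L[ℂ] V) {μ : ℂ} {b : ℝ}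
    (hb : μ.re < b) (k : ℕ) :
    ∀ v : V, ((T - μ • 1) ^ k) v = 0 →
      ∃ C : ℝ, ∀ t : ℝ, 0 ≤ t → ‖NormedSpace.exp (t • T) v‖ ≤ C * Real.exp (b * t) := by
  induction k with
  | zero =>
    intro v hv
    have : v = 0 := by simpa using hv
    exact ⟨0, fun t _ => by simp [this]⟩
  | succ k ih =>
    intro v hv
    obtain ⟨C, hC⟩ := ih ((T - μ • 1) v) (by rwa [pow_succ] at hv)
    have hc : 0 < b - μ.re := by linarith
    have hC0 : 0 ≤ C := by simpa using (norm_nonneg _).trans (hC 0 le_rfl)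
    refine ⟨‖v‖ + C / (b - μ.re), fun t ht => ?_⟩
    have hn : ∀ s : ℝ, ‖Complex.exp (s * (-μ))‖ = Real.exp (-μ.re * s) := fun s => by
      rw [Complex.norm_exp]; simp; ring
    have hd : ∀ s : ℝ, HasDerivAt
        (fun s : ℝ => Complex.exp (s * (-μ)) • (NormedSpace.exp (s • T) v))
        (Complex.exp (s * (-μ)) • (NormedSpace.exp (s • T) ((T - μ • 1) v))) s := by
      intro s
      have h1 : HasDerivAt (fun s : ℝ => NormedSpace.exp (s • T) v)
          ((NormedSpace.exp (s • T) * T) v) s :=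
        (((ContinuousLinearMap.apply ℂ V v).restrictScalars ℝ).hasFDerivAt.comp_hasDerivAt s
          (hasDerivAt_exp_smul_const T s))
      have h2 : HasDerivAt (fun s : ℝ => Complex.exp (s * (-μ)))
          (Complex.exp (s * (-μ)) * (-μ)) s := by
        have := ((Complex.ofRealCLM.hasDerivAt (x := s)).mul_const (-μ)).cexp
        simpa using this
      refine (h2.smul h1).congr_deriv ?_
      symm
      rw [_root_.sub_apply, map_sub, smul_sub, mul_smul, neg_smul, smul_neg, ← sub_eq_add_neg]
      congr 2
      exact (NormedSpace.exp (s • T)).map_smul μ v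
    have key := image_norm_le_of_norm_deriv_right_le_deriv_boundary
      (f := fun s : ℝ => Complex.exp (s * (-μ)) • (NormedSpace.exp (s • T) v))
      (a := 0) (b := t)
      (B := fun s => ‖v‖ + C / (b - μ.re) * (Real.exp ((b - μ.re) * s) - 1))
      (B' := fun s => C * Real.exp ((b - μ.re) * s))
      (fun s _ => (hd s).continuousAt.continuousWithinAt)
      (fun s _ => (hd s).hasDerivWithinAt) (by simp)
      (fun s => by
        have : HasDerivAt (fun s : ℝ => Real.exp ((b - μ.re) * s))
          (Real.exp ((b - μ.re) * s) * (b - μ.re)) s := by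
          simpa using ((hasDerivAt_id s).const_mul (b - μ.re)).exp
        refine (((this.sub_const 1).const_mul (C / (b - μ.re))).const_add ‖v‖).congr_deriv ?_
        rw [mul_comm (Real.exp _), ← mul_assoc, div_mul_cancel₀ _ hc.ne'])
      (fun s hs => by
        rw [norm_smul, hn]
        calc _ ≤ Real.exp (-μ.re * s) * (C * Real.exp (b * s)) := by gcongr; exact hC s hs.1
          _ = _ := by rw [mul_left_comm, ← Real.exp_add]; ring_nf)
      (right_mem_Icc.2 ht)
    rw [norm_smul, hn] at key
    have e1 : Real.exp (μ.re * t) * Real.exp (-μ.re * t) = 1 := by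
      rw [← Real.exp_add]; simp
    have e2 : Real.exp (μ.re * t) * Real.exp ((b - μ.re) * t) = Real.exp (b * t) := by
      rw [← Real.exp_add]; ring_nf
    have e3 : Real.exp (μ.re * t) ≤ Real.exp (b * t) := by gcongr
    have e4 : 0 ≤ C / (b - μ.re) := by positivity
    calc ‖NormedSpace.exp (t • T) v‖
        = Real.exp (μ.re * t) * (Real.exp (-μ.re * t) * ‖NormedSpace.exp (t • T) v‖) := by
          rw [← mul_assoc, e1, one_mul]
      _ ≤ Real.exp (μ.re * t) *
          (‖v‖ + C / (b - μ.re) * (Real.exp ((b - μ.re) * t) - 1)) := by gcongr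
      _ = Real.exp (μ.re * t) * ‖v‖ + C / (b - μ.re) * Real.exp (b * t)
          - C / (b - μ.re) * Real.exp (μ.re * t) := by rw [← e2]; ring
      _ ≤ Real.exp (b * t) * ‖v‖ + C / (b - μ.re) * Real.exp (b * t) := by
          have := mul_nonneg e4 (Real.exp_pos (μ.re * t)).le
          have := mul_le_mul_of_nonneg_right e3 (norm_nonneg v)
          linarith
      _ = _ := by ring

theorem exists_norm_exp_apply_le [FiniteDimensional ℂ V] (T : V →L[ℂ] V) {b : ℝ}
    (hT : ∀ μ, Module.End.HasEigenvalue (T : Module.End ℂ V) μ → μ.re < b) (v : V) :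
    ∃ C : ℝ, ∀ t : ℝ, 0 ≤ t → ‖NormedSpace.exp (t • T) v‖ ≤ C * Real.exp (b * t) := by
  have hv : v ∈ ⨆ μ, Module.End.maxGenEigenspace (T : Module.End ℂ V) μ := by
    rw [Module.End.iSup_maxGenEigenspace_eq_top]; trivial
  induction hv using Submodule.iSup_induction' with
  | mem μ x hx =>
    by_cases h : Module.End.HasEigenvalue (T : Module.End ℂ V) μ
    · obtain ⟨k, hk⟩ := (Module.End.mem_maxGenEigenspace _ _ _).1 hx
      refine exists_norm_exp_apply_le_of_pow_apply_eq_zero T (hT μ h) k x ?_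
      have : (((T - μ • 1) ^ k : V →L[ℂ] V) : Module.End ℂ V)
          = ((T : Module.End ℂ V) - μ • 1) ^ k := by
        rw [ContinuousLinearMap.toLinearMap_pow]; rfl
      rw [← this] at hk
      exact hk
    · have h0 : Module.End.maxGenEigenspace (T : Module.End ℂ V) μ = ⊥ := by
        rw [Module.End.HasEigenvalue, ← Module.End.hasUnifEigenvalue_iff_hasUnifEigenvalue_one
          (k := ⊤) (by simp)] at h
        exact not_not.1 h
      rw [h0] at hx
      exact ⟨0, fun t _ => by simp [(Submodule.mem_bot ℂ).1 hx]⟩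
  | zero => exact ⟨0, fun t _ => by simp⟩
  | add x y _ _ hx hy =>
    obtain ⟨C, hC⟩ := hx
    obtain ⟨D, hD⟩ := hy
    refine ⟨C + D, fun t ht => ?_⟩
    rw [map_add, add_mul]
    exact (norm_add_le _ _).trans (add_le_add (hC t ht) (hD t ht))

end GeneralizedEigenvectors

theorem exists_norm_le_of_forall_apply {𝕜 V W : Type*} [RCLike 𝕜] [NormedAddCommGroup V]
    [NormedSpace 𝕜 V] [CompleteSpace V] [NormedAddCommGroup W] [NormedSpace 𝕜 W]
    (S : ℝ → V →L[𝕜] W) {b : ℝ}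
    (h : ∀ v, ∃ C : ℝ, ∀ t : ℝ, 0 ≤ t → ‖S t v‖ ≤ C * Real.exp (b * t)) :
    ∃ C : ℝ, ∀ t : ℝ, 0 ≤ t → ‖S t‖ ≤ C * Real.exp (b * t) := by
  obtain ⟨C, hC⟩ := banach_steinhaus
    (g := fun t : {t : ℝ // 0 ≤ t} => ((Real.exp (-(b * t)) : ℝ) : 𝕜) • S t) (by
      intro v
      obtain ⟨C, hC⟩ := h v
      refine ⟨C, fun t => ?_⟩
      have := hC t t.2
      rw [_root_.smul_apply, norm_smul, RCLike.norm_ofReal,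
        abs_of_pos (Real.exp_pos _), Real.exp_neg]
      rwa [inv_mul_le_iff₀ (Real.exp_pos _), mul_comm])
  refine ⟨C, fun t ht => ?_⟩
  have := hC ⟨t, ht⟩
  rw [norm_smul, RCLike.norm_ofReal,
        abs_of_pos (Real.exp_pos _), Real.exp_neg] at this
  rwa [inv_mul_le_iff₀ (Real.exp_pos _), mul_comm] at this

theorem hasDerivAt_exp_smul_apply {X : Type*} [NormedAddCommGroup X] [NormedSpace ℝ X]
    [CompleteSpace X] (A : X →L[ℝ] X) (v : X) (t : ℝ) :
    HasDerivAt (fun s : ℝ => NormedSpace.exp (s • A) v) (A (NormedSpace.exp (t • A) v)) t := by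
  have h := (hasDerivAt_exp_smul_const' A t).clm_apply (hasDerivAt_const t v)
  simpa using h

theorem exists_norm_exp_mulVecLin_le {n : ℕ} (M : Matrix (Fin n) (Fin n) ℝ) {b : ℝ}
    (hM : ∀ μ ∈ (M.charpoly.map (algebraMap ℝ ℂ)).roots, μ.re < b) :
    ∃ C : ℝ, ∀ t : ℝ, 0 ≤ t →
      ‖NormedSpace.exp (t • M.mulVecLin.toContinuousLinearMap)‖ ≤ C * Real.exp (b * t) := by
  set A := M.mulVecLin.toContinuousLinearMap with hA
  set T := (Matrix.toLin' (M.map (algebraMap ℝ ℂ))).toContinuousLinearMap with hT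
  refine exists_norm_le_of_forall_apply _ fun v => ?_
  let ι : (Fin n → ℝ) →L[ℝ] (Fin n → ℂ) :=
    ContinuousLinearMap.pi fun i => Complex.ofRealCLM.comp (ContinuousLinearMap.proj i)
  have hι : ∀ x, ‖ι x‖ = ‖x‖ := fun x => by
    simp [ι, Pi.norm_def, Complex.nnnorm_real]
  have hιA : ∀ x, ι (A x) = T (ι x) := fun x => by
    ext i
    simp [ι, hA, hT, Matrix.mulVec, dotProduct]
  have hflow : (fun t : ℝ => ι (NormedSpace.exp (t • A) v))
      = fun t : ℝ => NormedSpace.exp (t • T) (ι v) := by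
    refine ODE_solution_unique_univ (v := fun _ z => T z) (s := fun _ => univ) (K := ‖T‖₊) (t₀ := 0)
      (fun t => T.lipschitz.lipschitzOnWith) (fun t => ⟨?_, trivial⟩) (fun t => ⟨?_, trivial⟩)
      (by
        have h0 : NormedSpace.exp ((0 : ℝ) • T) = 1 := by
          rw [show (0 : ℝ) • T = 0 from zero_smul ℝ T, NormedSpace.exp_zero]
        rw [h0]
        simp)
    · have h := ι.hasFDerivAt.comp_hasDerivAt t (hasDerivAt_exp_smul_apply A v t)
      rw [hιA] at h
      exact h
    · have h := ((ContinuousLinearMap.apply ℂ _ (ι v)).restrictScalars ℝ).hasFDerivAt.comp_hasDerivAt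
        t (hasDerivAt_exp_smul_const' T t)
      exact h
  obtain ⟨C, hC⟩ := exists_norm_exp_apply_le T (b := b) (fun μ hμ => hM μ (by
    rw [Module.End.hasEigenvalue_iff_isRoot_charpoly] at hμ
    rw [← Matrix.charpoly_map, Polynomial.mem_roots (Matrix.charpoly_monic _).ne_zero]
    rwa [hT, LinearMap.coe_toContinuousLinearMap, Matrix.charpoly_toLin'] at hμ)) (ι v)
  refine ⟨C, fun t ht => ?_⟩
  rw [← hι]
  have := congrFun hflow t
  rw [this]
  exact hC t ht

section Linear

variable {X : Type*} [NormedAddCommGroup X] [NormedSpace ℝ X] [CompleteSpace X]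

theorem exp_smul_apply_exp_smul_apply (A : X →L[ℝ] X) (s t : ℝ) (v : X) :
    NormedSpace.exp (s • A) (NormedSpace.exp (t • A) v) = NormedSpace.exp ((s + t) • A) v := by
  exact (congrArg (fun S : X →L[ℝ] X => S v) (exp_add_smul A s t)).symm

theorem norm_le_of_hasDerivAt_add (A : X →L[ℝ] X) {C a c M r t : ℝ}
    (hA : ∀ τ : ℝ, 0 ≤ τ → ‖NormedSpace.exp (τ • A)‖ ≤ C * Real.exp (a * τ)) (hac : a < c)
    {x p : ℝ → X} (hrt : r ≤ t) (hx : ∀ s ∈ Icc r t, HasDerivAt x (A (x s) + p s) s)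
    (hp : ∀ s ∈ Icc r t, ‖p s‖ ≤ M * Real.exp (c * s)) :
    ‖x t‖ ≤ C * Real.exp (a * (t - r)) * ‖x r‖ + C * M / (c - a) * Real.exp (c * t) := by
  have hC : 0 ≤ C := by simpa using (norm_nonneg _).trans (hA 0 le_rfl)
  have hM : 0 ≤ M := by
    have := (norm_nonneg _).trans (hp t (right_mem_Icc.2 hrt))
    exact nonneg_of_mul_nonneg_left this (Real.exp_pos _)
  have hca : 0 < c - a := sub_pos.2 hac
  have hd : ∀ s ∈ Icc r t, HasDerivAt (fun s => NormedSpace.exp ((t - s) • A) (x s))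
      (NormedSpace.exp ((t - s) • A) (p s)) s := fun s hs => by
    have h1 : HasDerivAt (fun s : ℝ => NormedSpace.exp ((t - s) • A))
        (-(NormedSpace.exp ((t - s) • A) * A)) s :=
      (hasDerivAt_exp_smul_const A (t - s)).comp_const_sub t s
    refine (h1.clm_apply (hx s hs)).congr_deriv ?_
    simp
  have key := image_norm_le_of_norm_deriv_right_le_deriv_boundary
    (a := r) (b := t) (f := fun s => NormedSpace.exp ((t - s) • A) (x s))
    (B := fun s => C * Real.exp (a * (t - r)) * ‖x r‖ + C * M * Real.exp (a * t) / (c - a) *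
      (Real.exp ((c - a) * s) - Real.exp ((c - a) * r)))
    (B' := fun s => C * M * Real.exp (a * t) * Real.exp ((c - a) * s))
    (fun s hs => (hd s hs).continuousAt.continuousWithinAt)
    (fun s hs => (hd s (Ico_subset_Icc_self hs)).hasDerivWithinAt)
    (by
      simp only [sub_self, mul_zero, add_zero]
      exact (ContinuousLinearMap.le_opNorm _ _).trans
        (mul_le_mul_of_nonneg_right (hA _ (sub_nonneg.2 hrt)) (norm_nonneg _)))
    (fun s => by
      have : HasDerivAt (fun s : ℝ => Real.exp ((c - a) * s))
        (Real.exp ((c - a) * s) * (c - a)) s := by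
        simpa using ((hasDerivAt_id s).const_mul (c - a)).exp
      refine (((this.sub_const _).const_mul _).const_add _).congr_deriv ?_
      field_simp)
    (fun s hs => by
      calc _ ≤ C * Real.exp (a * (t - s)) * (M * Real.exp (c * s)) :=
            (ContinuousLinearMap.le_opNorm _ _).trans
              (mul_le_mul (hA _ (sub_nonneg.2 hs.2.le)) (hp s (Ico_subset_Icc_self hs))
                (norm_nonneg _) (by positivity))
        _ = C * M * (Real.exp (a * (t - s)) * Real.exp (c * s)) := by ring
        _ = C * M * (Real.exp (a * t) * Real.exp ((c - a) * s)) := by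
            rw [← Real.exp_add, ← Real.exp_add]; ring_nf
        _ = _ := by ring)
    (right_mem_Icc.2 hrt)
  simp only [sub_self, zero_smul, NormedSpace.exp_zero] at key
  have e : Real.exp (a * t) * Real.exp ((c - a) * t) = Real.exp (c * t) := by
    rw [← Real.exp_add]; ring_nf
  have h0 : 0 ≤ C * M * Real.exp (a * t) / (c - a) * Real.exp ((c - a) * r) := by positivity
  calc ‖x t‖ ≤ _ := key
    _ ≤ C * Real.exp (a * (t - r)) * ‖x r‖
        + C * M / (c - a) * (Real.exp (a * t) * Real.exp ((c - a) * t)) := by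
      have : C * M * Real.exp (a * t) / (c - a) * Real.exp ((c - a) * t)
        = C * M / (c - a) * (Real.exp (a * t) * Real.exp ((c - a) * t)) := by ring
      rw [mul_sub (C * M * Real.exp (a * t) / (c - a)), this]
      linarith
    _ = _ := by rw [e]

theorem norm_le_of_subexponential (A : X →L[ℝ] X) {C a γ M : ℝ}
    (hA : ∀ τ : ℝ, ‖NormedSpace.exp (τ • A)‖ ≤ C * Real.exp (a * |τ|)) (haγ : a < γ)
    {x p : ℝ → X} (hx : ∀ s, HasDerivAt x (A (x s) + p s) s)
    (hp : ∀ s, ‖p s‖ ≤ M * Real.exp (γ * |s|)) (t : ℝ) :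
    ‖x t‖ ≤ (C * ‖x 0‖ + C * M / (γ - a)) * Real.exp (γ * |t|) := by
  have hC : 0 ≤ C := by simpa using (norm_nonneg _).trans (hA 0)
  have main : ∀ t, 0 ≤ t → C * Real.exp (a * (t - 0)) * ‖x 0‖ + C * M / (γ - a) * Real.exp (γ * t)
      ≤ (C * ‖x 0‖ + C * M / (γ - a)) * Real.exp (γ * t) := fun t ht => by
    have : Real.exp (a * (t - 0)) ≤ Real.exp (γ * t) := by rw [sub_zero]; gcongr
    rw [add_mul, mul_right_comm]
    gcongr
  rcases le_total 0 t with ht | ht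
  · rw [abs_of_nonneg ht]
    refine le_trans (norm_le_of_hasDerivAt_add A (M := M) (fun τ hτ => ?_) haγ ht
      (fun s _ => hx s) (fun s hs => ?_)) (main t ht)
    · simpa [abs_of_nonneg hτ] using hA τ
    · simpa [abs_of_nonneg hs.1] using hp s
  · rw [abs_of_nonpos ht]
    have h := norm_le_of_hasDerivAt_add (-A) (M := M) (C := C) (a := a) (c := γ) (r := 0) (t := -t)
      (x := fun s => x (-s)) (p := fun s => -p (-s)) (fun τ hτ => ?_) haγ
      (by linarith) (fun s _ => ?_) (fun s hs => ?_)
    · simp only [neg_neg, neg_zero] at h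
      exact h.trans (main (-t) (by linarith))
    · have := hA (-τ)
      rwa [abs_neg, abs_of_nonneg hτ, neg_smul, ← smul_neg] at this
    · have h2 := (hx (-s)).scomp s (hasDerivAt_neg s)
      refine h2.congr_deriv ?_
      simp [add_comm]
    · have := hp (-s)
      rw [norm_neg]
      rwa [abs_neg, abs_of_nonneg hs.1] at this

theorem norm_le_of_exponentiallyStable (B : X →L[ℝ] X) {C β γ M N : ℝ}
    (hB : ∀ τ : ℝ, 0 ≤ τ → ‖NormedSpace.exp (τ • B)‖ ≤ C * Real.exp (-β * τ)) (hγ : 0 ≤ γ)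
    (hγβ : γ < β) {y q : ℝ → X} (hy : ∀ s, HasDerivAt y (B (y s) + q s) s)
    (hyN : ∀ s, ‖y s‖ ≤ N * Real.exp (γ * |s|))
    (hq : ∀ s, ‖q s‖ ≤ M * Real.exp (γ * |s|)) (t : ℝ) :
    ‖y t‖ ≤ C * M / (β - γ) * Real.exp (γ * |t|) := by
  have hC : 0 ≤ C := by simpa using (norm_nonneg _).trans (hB 0 le_rfl)
  have hM : 0 ≤ M := by simpa using (norm_nonneg _).trans (hq 0)
  have hlim : Tendsto (fun r => C * N * Real.exp (-β * t) * Real.exp ((β - γ) * r)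
      + C * M / (β - γ) * Real.exp (γ * |t|)) atBot
      (𝓝 (C * N * Real.exp (-β * t) * 0 + C * M / (β - γ) * Real.exp (γ * |t|))) := by
    refine Tendsto.add_const _ (Tendsto.const_mul _ (Real.tendsto_exp_atBot.comp ?_))
    exact tendsto_id.const_mul_atBot (sub_pos.2 hγβ)
  rw [mul_zero, zero_add] at hlim
  refine ge_of_tendsto hlim ?_
  filter_upwards [eventually_le_atBot t, eventually_le_atBot 0] with r hrt hr0
  have h := norm_le_of_hasDerivAt_add B (M := M * Real.exp (γ * |t| + γ * t)) (c := -γ) hB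
    (by linarith) hrt (fun s _ => hy s) (fun s hs => (hq s).trans ?_)
  · refine h.trans (add_le_add ?_ (le_of_eq ?_))
    · calc _ ≤ C * Real.exp (-β * (t - r)) * (N * Real.exp (γ * |r|)) := by gcongr; exact hyN r
        _ = C * N * (Real.exp (-β * (t - r)) * Real.exp (γ * |r|)) := by ring
        _ = C * N * (Real.exp (-β * t) * Real.exp ((β - γ) * r)) := by
          rw [← Real.exp_add, ← Real.exp_add, abs_of_nonpos hr0]; ring_nf
        _ = _ := by ring
    · rw [show -γ - -β = β - γ by ring, ← mul_assoc, mul_div_right_comm, mul_assoc,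
        ← Real.exp_add]
      ring_nf
  · rw [mul_assoc, ← Real.exp_add]
    gcongr
    have : |s| ≤ |t| + (t - s) := by
      have := abs_sub_abs_le_abs_sub s t
      rw [abs_sub_comm, abs_of_nonneg (sub_nonneg.2 hs.2)] at this
      linarith
    nlinarith

theorem hasDerivAt_exp_smul_apply_of_hasDerivAt (A : X →L[ℝ] X) {z p : ℝ → X} {t : ℝ}
    (hz : HasDerivAt z (NormedSpace.exp ((-t) • A) (p t)) t) :
    HasDerivAt (fun s => NormedSpace.exp (s • A) (z s))
      (A (NormedSpace.exp (t • A) (z t)) + p t) t := by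
  refine ((hasDerivAt_exp_smul_const' A t).clm_apply hz).congr_deriv ?_
  rw [exp_smul_apply_exp_smul_apply]
  simp

theorem continuous_exp_smul (A : X →L[ℝ] X) : Continuous fun t : ℝ => NormedSpace.exp (t • A) :=
  continuous_iff_continuousAt.2 fun t => (hasDerivAt_exp_smul_const A t).continuousAt

theorem exists_hasDerivAt_add (A : X →L[ℝ] X) {p : ℝ → X} (hp : Continuous p) (ξ : X) :
    ∃ x : ℝ → X, (∀ t, HasDerivAt x (A (x t) + p t) t) ∧ x 0 = ξ := by
  have hc : Continuous fun s : ℝ => NormedSpace.exp ((-s) • A) (p s) :=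
    ((continuous_exp_smul A).comp continuous_neg).clm_apply hp
  refine ⟨fun t => NormedSpace.exp (t • A) (ξ + ∫ s in (0 : ℝ)..t, NormedSpace.exp ((-s) • A) (p s)),
    fun t => hasDerivAt_exp_smul_apply_of_hasDerivAt A ?_, by simp⟩
  exact (hc.integral_hasStrictDerivAt 0 t).hasDerivAt.const_add ξ

theorem exists_hasDerivAt_add_norm_le_of_exponentiallyStable (B : X →L[ℝ] X) {C β γ M : ℝ}
    (hB : ∀ τ : ℝ, 0 ≤ τ → ‖NormedSpace.exp (τ • B)‖ ≤ C * Real.exp (-β * τ)) (hγ : 0 ≤ γ)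
    (hγβ : γ < β) {q : ℝ → X} (hqc : Continuous q)
    (hq : ∀ s, ‖q s‖ ≤ M * Real.exp (γ * |s|)) :
    ∃ y : ℝ → X, (∀ t, HasDerivAt y (B (y t) + q t) t) ∧
      ∀ t, ‖y t‖ ≤ C * M / (β - γ) * Real.exp (γ * |t|) := by
  have hC : 0 ≤ C := by simpa using (norm_nonneg _).trans (hB 0 le_rfl)
  have hM : 0 ≤ M := by simpa using (norm_nonneg _).trans (hq 0)
  have hβγ : 0 < β - γ := sub_pos.2 hγβ
  set f : ℝ → X := fun s => NormedSpace.exp ((-s) • B) (q s) with hf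
  have hfc : Continuous f := ((continuous_exp_smul B).comp continuous_neg).clm_apply hqc
  have hbound : ∀ t, ∀ s ∈ Iic t, ‖NormedSpace.exp (t • B) (f s)‖
      ≤ C * M * Real.exp (γ * |t| - (β - γ) * t) * Real.exp ((β - γ) * s) := fun t s hs => by
    rw [hf, exp_smul_apply_exp_smul_apply]
    have hts : 0 ≤ t + -s := by have := mem_Iic.1 hs; linarith
    have habs : |s| ≤ |t| + (t - s) := by
      have := abs_sub_abs_le_abs_sub s t
      rw [abs_sub_comm, abs_of_nonneg (a := t - s) (by linarith)] at this
      linarith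
    calc _ ≤ C * Real.exp (-β * (t + -s)) * (M * Real.exp (γ * |s|)) :=
          (ContinuousLinearMap.le_opNorm _ _).trans
            (mul_le_mul (hB _ hts) (hq s) (norm_nonneg _) (by positivity))
      _ ≤ C * Real.exp (-β * (t + -s)) * (M * Real.exp (γ * (|t| + (t - s)))) := by gcongr
      _ = C * M * (Real.exp (-β * (t + -s)) * Real.exp (γ * (|t| + (t - s)))) := by ring
      _ = C * M * (Real.exp (γ * |t| - (β - γ) * t) * Real.exp ((β - γ) * s)) := by
          rw [← Real.exp_add, ← Real.exp_add]; ring_nf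
      _ = _ := by ring
  have hgint : ∀ t, MeasureTheory.IntegrableOn (fun s => NormedSpace.exp (t • B) (f s)) (Iic t) :=
    fun t => ((integrableOn_exp_mul_Iic hβγ t).const_mul _).mono'
      (((NormedSpace.exp (t • B)).continuous.comp hfc).aestronglyMeasurable)
      ((MeasureTheory.ae_restrict_mem measurableSet_Iic).mono (hbound t))
  have hfint : ∀ t, MeasureTheory.IntegrableOn f (Iic t) := fun t => by
    have := (NormedSpace.exp ((-t) • B)).integrable_comp (hgint t)
    simp only [exp_smul_apply_exp_smul_apply, neg_add_cancel, zero_smul, NormedSpace.exp_zero,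
      one_apply_eq_self] at this
    exact this
  refine ⟨fun t => NormedSpace.exp (t • B) (∫ s in Iic t, f s),
    fun t => hasDerivAt_exp_smul_apply_of_hasDerivAt B ?_, fun t => ?_⟩
  · have h : (fun t => ∫ s in Iic t, f s)
        = fun t => (∫ s in Iic 0, f s) + ∫ s in (0 : ℝ)..t, f s := by
      ext t
      rw [← intervalIntegral.integral_Iic_sub_Iic (hfint 0) (hfint t)]
      abel
    rw [h]
    exact (hfc.integral_hasStrictDerivAt 0 t).hasDerivAt.const_add _
  · simp only
    rw [← ContinuousLinearMap.integral_comp_comm _ (hfint t)]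
    calc _ ≤ ∫ s in Iic t,
          C * M * Real.exp (γ * |t| - (β - γ) * t) * Real.exp ((β - γ) * s) :=
          MeasureTheory.norm_integral_le_of_norm_le
            ((integrableOn_exp_mul_Iic hβγ t).const_mul _)
            ((MeasureTheory.ae_restrict_mem measurableSet_Iic).mono (hbound t))
      _ = C * M / (β - γ) * (Real.exp (γ * |t| - (β - γ) * t) * Real.exp ((β - γ) * t)) := by
          rw [MeasureTheory.integral_const_mul, integral_exp_mul_Iic hβγ]; ring
      _ = _ := by rw [← Real.exp_add]; ring_nf

end Linear

section Nonlinear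

variable {X Y : Type*} [NormedAddCommGroup X] [NormedSpace ℝ X]
  [NormedAddCommGroup Y] [NormedSpace ℝ Y]

/-- For forcing terms of growth rate at most `exp (γ * |t|)`, the inhomogeneous linear equation
`u' = L u + p` is well posed, with constant `K`, in the class of curves with the same growth rate,
when the first component of `u 0` is prescribed. The second component is controlled by the forcing
alone. -/
structure CentreStable (L : X × Y →L[ℝ] X × Y) (γ K : ℝ) : Prop where
  bound : ∀ (u p : ℝ → X × Y) (N M : ℝ), (∀ t, HasDerivAt u (L (u t) + p t) t) →
    (∀ t, ‖u t‖ ≤ N * Real.exp (γ * |t|)) → (∀ t, ‖p t‖ ≤ M * Real.exp (γ * |t|)) →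
    ∀ t, ‖(u t).1‖ ≤ K * (‖(u 0).1‖ + M) * Real.exp (γ * |t|) ∧
      ‖(u t).2‖ ≤ K * M * Real.exp (γ * |t|)
  exist : ∀ (p : ℝ → X × Y) (M : ℝ), Continuous p → (∀ t, ‖p t‖ ≤ M * Real.exp (γ * |t|)) →
    ∀ ξ : X, ∃ (u : ℝ → X × Y) (N : ℝ), (∀ t, HasDerivAt u (L (u t) + p t) t) ∧
      (∀ t, ‖u t‖ ≤ N * Real.exp (γ * |t|)) ∧ (u 0).1 = ξ

theorem centreStable_prodMap [CompleteSpace X] [CompleteSpace Y] (A : X →L[ℝ] X)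
    (B : Y →L[ℝ] Y) {a β γ C D K : ℝ}
    (hA : ∀ τ : ℝ, ‖NormedSpace.exp (τ • A)‖ ≤ C * Real.exp (a * |τ|))
    (hB : ∀ τ : ℝ, 0 ≤ τ → ‖NormedSpace.exp (τ • B)‖ ≤ D * Real.exp (-β * τ))
    (hγ : 0 ≤ γ) (haγ : a < γ) (hγβ : γ < β)
    (hK₁ : C ≤ K) (hK₂ : C / (γ - a) ≤ K) (hK₃ : D / (β - γ) ≤ K) :
    CentreStable (A.prodMap B) γ K where
  bound u p N M hu huN hp t := by
    have hM : 0 ≤ M := by simpa using (norm_nonneg _).trans (hp 0)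
    refine ⟨?_, ?_⟩
    · have h := norm_le_of_subexponential A hA haγ (x := fun t => (u t).1) (p := fun t => (p t).1)
        (M := M) (fun s => (ContinuousLinearMap.fst ℝ X Y).hasFDerivAt.comp_hasDerivAt s (hu s))
        (fun s => (norm_fst_le _).trans (hp s)) t
      refine h.trans ?_
      rw [mul_add, mul_div_right_comm]
      gcongr
    · have h := norm_le_of_exponentiallyStable B hB hγ hγβ (y := fun t => (u t).2)
        (q := fun t => (p t).2) (M := M) (N := N)
        (fun s => (ContinuousLinearMap.snd ℝ X Y).hasFDerivAt.comp_hasDerivAt s (hu s))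
        (fun s => (norm_snd_le _).trans (huN s))
        (fun s => (norm_snd_le _).trans (hp s)) t
      refine h.trans ?_
      rw [mul_div_right_comm]
      gcongr
  exist p M hpc hp ξ := by
    obtain ⟨x, hx, hx0⟩ := exists_hasDerivAt_add A (p := fun t => (p t).1) (by fun_prop) ξ
    obtain ⟨y, hy, hyN⟩ := exists_hasDerivAt_add_norm_le_of_exponentiallyStable B hB hγ hγβ
      (q := fun t => (p t).2) (M := M) (by fun_prop) (fun s => (norm_snd_le _).trans (hp s))
    have hxN := norm_le_of_subexponential A hA haγ hx (M := M)
      (fun s => (norm_fst_le _).trans (hp s))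
    refine ⟨fun t => (x t, y t), max (C * ‖x 0‖ + C * M / (γ - a)) (D * M / (β - γ)),
      fun t => ((hx t).prodMk (hy t)).congr_deriv rfl, fun t => ?_, hx0⟩
    exact norm_prod_le_iff.2 ⟨(hxN t).trans (by gcongr; exact le_max_left _ _),
      (hyN t).trans (by gcongr; exact le_max_right _ _)⟩

namespace CentreStable

variable {L : X × Y →L[ℝ] X × Y} {γ K ε : ℝ}

theorem norm_le (h : CentreStable L γ K) (hK : 0 ≤ K) {u p : ℝ → X × Y} {N M : ℝ}
    (hu : ∀ t, HasDerivAt u (L (u t) + p t) t) (huN : ∀ t, ‖u t‖ ≤ N * Real.exp (γ * |t|))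
    (hp : ∀ t, ‖p t‖ ≤ M * Real.exp (γ * |t|)) (t : ℝ) :
    ‖u t‖ ≤ K * (‖(u 0).1‖ + M) * Real.exp (γ * |t|) := by
  obtain ⟨h1, h2⟩ := h.bound u p N M hu huN hp t
  refine norm_prod_le_iff.2 ⟨h1, h2.trans ?_⟩
  gcongr
  exact le_add_of_nonneg_left (norm_nonneg _)

theorem norm_le_of_norm_le_add (h : CentreStable L γ K) (hK : 0 ≤ K) (hε : 0 ≤ ε)
    (hKε : K * ε ≤ 1 / 2) {u p : ℝ → X × Y} {N M : ℝ}
    (hu : ∀ t, HasDerivAt u (L (u t) + p t) t) (huN : ∀ t, ‖u t‖ ≤ N * Real.exp (γ * |t|))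
    (hp : ∀ t, ‖p t‖ ≤ ε * ‖u t‖ + M * Real.exp (γ * |t|)) (t : ℝ) :
    ‖u t‖ ≤ 2 * K * (‖(u 0).1‖ + M) * Real.exp (γ * |t|) := by
  set S := ⨆ t, ‖u t‖ / Real.exp (γ * |t|)
  have hbdd : BddAbove (range fun t => ‖u t‖ / Real.exp (γ * |t|)) :=
    ⟨N, by rintro _ ⟨t, rfl⟩; exact (div_le_iff₀ (Real.exp_pos _)).2 (huN t)⟩
  have hS : ∀ t, ‖u t‖ ≤ S * Real.exp (γ * |t|) := fun t =>
    (div_le_iff₀ (Real.exp_pos _)).1 (le_ciSup hbdd t)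
  have hS0 : 0 ≤ S := by simpa using (norm_nonneg _).trans (hS 0)
  have hS' : S ≤ K * (‖(u 0).1‖ + (ε * S + M)) := ciSup_le fun t => by
    rw [div_le_iff₀ (Real.exp_pos _)]
    refine h.norm_le hK hu huN (fun s => (hp s).trans ?_) t
    have := mul_le_mul_of_nonneg_left (hS s) hε
    linarith
  refine (hS t).trans ?_
  gcongr
  nlinarith [mul_le_mul_of_nonneg_right hKε hS0]

theorem eq_zero_of_norm_le (h : CentreStable L γ K) (hK : 0 ≤ K) (hε : 0 ≤ ε)
    (hKε : K * ε ≤ 1 / 2) {u p : ℝ → X × Y} {N : ℝ}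
    (hu : ∀ t, HasDerivAt u (L (u t) + p t) t) (huN : ∀ t, ‖u t‖ ≤ N * Real.exp (γ * |t|))
    (hp : ∀ t, ‖p t‖ ≤ ε * ‖u t‖) (h0 : (u 0).1 = 0) (t : ℝ) : u t = 0 := by
  have := h.norm_le_of_norm_le_add hK hε hKε (M := 0) hu huN (by simpa using hp) t
  simpa [h0] using this

theorem exists_solution [CompleteSpace X] [CompleteSpace Y] (h : CentreStable L γ K)
    (hK : 0 ≤ K) (hε : 0 ≤ ε)
    (hKε : K * ε ≤ 1 / 2) {Φ : ℝ → X × Y → X × Y} (hΦ : Continuous fun z : ℝ × (X × Y) => Φ z.1 z.2)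
    (hlip : ∀ t u v, ‖Φ t u - Φ t v‖ ≤ ε * ‖u - v‖) (hΦ0 : ∀ t, Φ t 0 = 0) (ξ : X) :
    ∃ (u : ℝ → X × Y) (N : ℝ), (∀ t, HasDerivAt u (L (u t) + Φ t (u t)) t) ∧
      (∀ t, ‖u t‖ ≤ N * Real.exp (γ * |t|)) ∧ (u 0).1 = ξ := by
  let p : BoundedContinuousFunction ℝ (X × Y) → ℝ → X × Y :=
    fun v t => Φ t (Real.exp (γ * |t|) • v t)
  have hpc : ∀ v, Continuous (p v) := fun v =>
    hΦ.comp (f := fun t : ℝ => (t, Real.exp (γ * |t|) • v t)) (by fun_prop)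
  have hpd : ∀ v w t, ‖p v t - p w t‖ ≤ ε * ‖v - w‖ * Real.exp (γ * |t|) := fun v w t => by
    refine (hlip t _ _).trans ?_
    rw [← smul_sub, norm_smul, Real.norm_eq_abs, abs_of_pos (Real.exp_pos _), mul_assoc,
      mul_comm ‖v - w‖]
    gcongr
    exact (v - w).norm_coe_le_norm t
  have hpb : ∀ v t, ‖p v t‖ ≤ ε * ‖v‖ * Real.exp (γ * |t|) := fun v t => by
    simpa [p, hΦ0] using hpd v 0 t
  choose S N hS hSN hS0 using fun v => h.exist (p v) (ε * ‖v‖) (hpc v) (hpb v) ξ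
  have hSc : ∀ v, Continuous (S v) := fun v =>
    continuous_iff_continuousAt.2 fun t => (hS v t).continuousAt
  let T : BoundedContinuousFunction ℝ (X × Y) → BoundedContinuousFunction ℝ (X × Y) := fun v =>
    BoundedContinuousFunction.ofNormedAddCommGroup (fun t => (Real.exp (γ * |t|))⁻¹ • S v t)
      ((Continuous.inv₀ (by fun_prop) fun t => (Real.exp_pos _).ne').smul (hSc v)) (N v) (fun t => by
        rw [norm_smul, norm_inv, Real.norm_eq_abs, abs_of_pos (Real.exp_pos _),
          inv_mul_le_iff₀ (Real.exp_pos _), mul_comm]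
        exact hSN v t)
  have hT : ContractingWith (1 / 2) T := by
    refine ⟨by rw [← NNReal.coe_lt_coe]; norm_num, LipschitzWith.of_dist_le_mul fun v w => ?_⟩
    rw [BoundedContinuousFunction.dist_le (by positivity)]
    intro t
    have hb := h.norm_le hK (u := fun t => S v t - S w t) (p := fun t => p v t - p w t)
      (N := N v + N w) (M := ε * ‖v - w‖)
      (fun t => ((hS v t).sub (hS w t)).congr_deriv (by rw [map_sub]; abel))
      (fun t => by
        rw [add_mul]
        exact (norm_sub_le _ _).trans (add_le_add (hSN v t) (hSN w t))) (hpd v w) t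
    simp only [Prod.fst_sub, hS0, sub_self, norm_zero, zero_add] at hb
    change dist ((Real.exp (γ * |t|))⁻¹ • S v t) ((Real.exp (γ * |t|))⁻¹ • S w t) ≤ _
    rw [dist_eq_norm, ← smul_sub, norm_smul, norm_inv, Real.norm_eq_abs,
      abs_of_pos (Real.exp_pos _), inv_mul_le_iff₀ (Real.exp_pos _), dist_eq_norm, mul_comm]
    refine hb.trans ?_
    rw [← mul_assoc]
    gcongr
    simpa using hKε
  let v := ContractingWith.fixedPoint T hT
  have hv : T v = v := hT.fixedPoint_isFixedPt
  refine ⟨S v, N v, fun t => ?_, hSN v, hS0 v⟩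
  have hvt : Real.exp (γ * |t|) • v t = S v t := by
    conv_lhs => rw [← hv]
    change _ • ((Real.exp (γ * |t|))⁻¹ • S v t) = _
    rw [smul_inv_smul₀ (Real.exp_pos _).ne']
  have := hS v t
  simp only [p, hvt] at this
  exact this

end CentreStable

end Nonlinear

theorem contDiff_one_of_norm_sub_sub_le_sq {X Y : Type*} [NormedAddCommGroup X] [NormedSpace ℝ X]
    [NormedAddCommGroup Y] [NormedSpace ℝ Y] {h : X → Y} {D : X → X →L[ℝ] Y} {K : ℝ}
    (hK : ∀ x y, ‖h y - h x - D x (y - x)‖ ≤ K * ‖y - x‖ ^ 2) :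
    ContDiff ℝ 1 h ∧ ∀ x, fderiv ℝ h x = D x := by
  have hd : ∀ x, HasFDerivAt h (D x) x := fun x => by
    rw [hasFDerivAt_iff_isLittleO]
    have h1 : (fun y => h y - h x - D x (y - x)) =O[𝓝 x] fun y => ‖y - x‖ ^ 2 :=
      Asymptotics.IsBigO.of_bound K (Eventually.of_forall fun y => by simpa using hK x y)
    exact h1.trans_isLittleO (Asymptotics.isLittleO_pow_sub_sub x one_lt_two)
  have hlip : ∀ x y, ‖D y - D x‖ ≤ 6 * |K| * ‖y - x‖ := fun x y => by
    have hK' : ∀ x y, ‖h y - h x - D x (y - x)‖ ≤ |K| * ‖y - x‖ ^ 2 := fun x y =>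
      (hK x y).trans (by gcongr; exact le_abs_self K)
    rcases eq_or_ne y x with rfl | hne
    · simp
    have hpos : 0 < ‖y - x‖ := norm_pos_iff.2 (sub_ne_zero.2 hne)
    refine ContinuousLinearMap.opNorm_le_bound _ (by positivity) fun v => ?_
    rcases eq_or_ne v 0 with rfl | hv
    · simp
    have hv' : 0 < ‖v‖ := norm_pos_iff.2 hv
    have hw : ∀ w : X, ‖w‖ = ‖y - x‖ → ‖(D y - D x) w‖ ≤ 6 * |K| * ‖y - x‖ ^ 2 := fun w hw => by
      have e : (D y - D x) w = (h (y + w) - h x - D x (y + w - x)) - (h y - h x - D x (y - x))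
          - (h (y + w) - h y - D y (y + w - y)) := by
        simp only [_root_.sub_apply, map_sub, map_add]
        abel
      rw [e]
      have a1 := hK' x (y + w)
      have a2 := hK' x y
      have a3 := hK' y (y + w)
      rw [add_sub_cancel_left, hw] at a3
      have a4 : ‖y + w - x‖ ≤ 2 * ‖y - x‖ := by
        have := norm_add_le (y - x) w
        rw [show y - x + w = y + w - x by abel] at this
        linarith
      have a5 : |K| * ‖y + w - x‖ ^ 2 ≤ |K| * (2 * ‖y - x‖) ^ 2 := by gcongr
      rw [add_sub_cancel_left]
      refine (norm_sub_le _ _).trans ((add_le_add_left (norm_sub_le _ _) _).trans ?_)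
      linarith
    have := hw ((‖y - x‖ / ‖v‖) • v) (by
      rw [norm_smul, Real.norm_of_nonneg (by positivity), div_mul_cancel₀ _ hv'.ne'])
    rw [map_smul, norm_smul, Real.norm_of_nonneg (by positivity), div_mul_eq_mul_div,
      div_le_iff₀ hv'] at this
    refine le_of_mul_le_mul_left ?_ hpos
    linarith
  have hcont : Continuous D := by
    have : LipschitzWith (Real.toNNReal (6 * |K|)) D := LipschitzWith.of_dist_le_mul fun y x => by
      rw [dist_eq_norm, dist_eq_norm, Real.coe_toNNReal _ (by positivity)]
      exact hlip x y
    exact this.continuous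
  have hfd : fderiv ℝ h = D := funext fun x => (hd x).fderiv
  exact ⟨contDiff_one_iff_fderiv.2 ⟨fun x => (hd x).differentiableAt, hfd ▸ hcont⟩, congrFun hfd⟩

theorem exists_cutoff {E G : Type*} [NormedAddCommGroup E] [NormedSpace ℝ E]
    [FiniteDimensional ℝ E] [NormedAddCommGroup G] [NormedSpace ℝ G] {F : E → G}
    (hF : ContDiff ℝ 2 F) (hF0 : F 0 = 0) (hdF0 : fderiv ℝ F 0 = 0) {ε : ℝ} (hε : 0 < ε) :
    ∃ δ > (0 : ℝ), ∃ (H : E → G) (K : ℝ), (∀ z, ‖z‖ < δ → H z = F z) ∧ ContDiff ℝ 2 H ∧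
      H 0 = 0 ∧ fderiv ℝ H 0 = 0 ∧ (∀ u v, ‖H u - H v‖ ≤ ε * ‖u - v‖) ∧
      ∀ u v, ‖H v - H u - fderiv ℝ H u (v - u)‖ ≤ K * ‖v - u‖ ^ 2 := by
  let χ : ContDiffBump (0 : E) := ⟨1, 2, one_pos, one_lt_two⟩
  let ρ : E → E := fun z => χ z • z
  have hρ : ContDiff ℝ 2 ρ := χ.contDiff.smul contDiff_id
  have hρc : HasCompactSupport ρ := χ.hasCompactSupport.smul_right
  obtain ⟨Λ, hΛ⟩ := hρ.lipschitzWith_of_hasCompactSupport hρc two_ne_zero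
  have hρ2 : ∀ z, ‖ρ z‖ ≤ 2 := fun z => by
    by_cases hz : z ∈ Metric.ball (0 : E) 2
    · rw [mem_ball_zero_iff] at hz
      calc ‖ρ z‖ = χ z * ‖z‖ := by rw [norm_smul, Real.norm_of_nonneg χ.nonneg]
        _ ≤ 1 * 2 := by gcongr; exact χ.le_one
        _ = 2 := by norm_num
    · have : χ z = 0 := by
        rw [← Function.notMem_support, χ.support_eq]; exact hz
      simp [ρ, this]
  let κ : NNReal := Real.toNNReal (ε / (Λ + 1))
  have hκ : (κ : ℝ) = ε / (Λ + 1) := Real.coe_toNNReal _ (by positivity)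
  have hκ0 : 0 < κ := by rw [← NNReal.coe_pos, hκ]; positivity
  obtain ⟨s, hs, hFs⟩ := (hF.contDiffAt.hasStrictFDerivAt
    two_ne_zero : HasStrictFDerivAt F (fderiv ℝ F 0) 0).exists_lipschitzOnWith_of_nnnorm_lt κ
      (by rwa [hdF0, nnnorm_zero])
  obtain ⟨r, hr, hrs⟩ := Metric.mem_nhds_iff.1 hs
  set δ := r / 3
  have hδ : 0 < δ := by positivity
  have hmem : ∀ z, δ • ρ (δ⁻¹ • z) ∈ s := fun z => hrs (by
    rw [mem_ball_zero_iff, norm_smul, Real.norm_of_nonneg hδ.le]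
    calc δ * ‖ρ (δ⁻¹ • z)‖ ≤ δ * 2 := by gcongr; exact hρ2 _
      _ < r := by simp only [δ]; linarith)
  let H : E → G := fun z => F (δ • ρ (δ⁻¹ • z))
  have hH : ContDiff ℝ 2 H := hF.comp ((hρ.comp (contDiff_id.const_smul δ⁻¹)).const_smul δ)
  have hHF : ∀ z, ‖z‖ < δ → H z = F z := fun z hz => by
    have : χ (δ⁻¹ • z) = 1 := by
      refine χ.one_of_mem_closedBall ?_
      rw [mem_closedBall_zero_iff, norm_smul, norm_inv, Real.norm_of_nonneg hδ.le,
        inv_mul_le_iff₀ hδ, mul_one]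
      exact hz.le
    simp only [H, ρ, this, one_smul, smul_inv_smul₀ hδ.ne']
  have hHc : HasCompactSupport H := by
    have h1 : HasCompactSupport fun z => ρ (δ⁻¹ • z) := hρc.comp_smul (inv_ne_zero hδ.ne')
    exact h1.comp_left (g := fun z => F (δ • z)) (by simpa using hF0)
  have hH' : ContDiff ℝ 1 (fderiv ℝ H) := hH.fderiv_right (by norm_num)
  obtain ⟨K, hK⟩ := hH'.lipschitzWith_of_hasCompactSupport (hHc.fderiv ℝ) one_ne_zero
  have hHd : Differentiable ℝ H := hH.differentiable two_ne_zero
  have heq : H =ᶠ[𝓝 0] F := by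
    filter_upwards [Metric.ball_mem_nhds 0 hδ] with z hz using hHF z (mem_ball_zero_iff.1 hz)
  refine ⟨δ, hδ, H, K, hHF, hH, by rw [hHF 0 (by simpa), hF0], by rw [heq.fderiv_eq, hdF0],
    fun u v => ?_, fun u v => ?_⟩
  · have h1 := hFs.dist_le_mul _ (hmem u) _ (hmem v)
    have h2 := hΛ.dist_le_mul (δ⁻¹ • u) (δ⁻¹ • v)
    rw [dist_smul₀, Real.norm_of_nonneg hδ.le] at h1
    rw [dist_smul₀, norm_inv, Real.norm_of_nonneg hδ.le] at h2
    rw [← dist_eq_norm, ← dist_eq_norm]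
    calc dist (H u) (H v) ≤ κ * (δ * (Λ * (δ⁻¹ * dist u v))) := h1.trans (by gcongr)
      _ = κ * Λ * dist u v := by field_simp
      _ ≤ ε * dist u v := by
        gcongr
        rw [hκ, div_mul_eq_mul_div, div_le_iff₀ (by positivity)]
        nlinarith [Λ.2]
  · have := (convex_closedBall u ‖v - u‖).norm_image_sub_le_of_norm_hasFDerivWithin_le' (𝕜 := ℝ)
      (f := H) (f' := fderiv ℝ H) (φ := fderiv ℝ H u) (C := K * ‖v - u‖) (x := u) (y := v)
      (fun x _ => (hHd x).hasFDerivAt.hasFDerivWithinAt)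
      (fun x hx => by
        rw [← dist_eq_norm]
        refine (hK.dist_le_mul x u).trans ?_
        gcongr
        exact hx)
      (by simp) (by simp [dist_eq_norm])
    refine this.trans (le_of_eq (by ring))

section Manifold

variable {X Y : Type*} [NormedAddCommGroup X] [NormedSpace ℝ X] [FiniteDimensional ℝ X]
  [NormedAddCommGroup Y] [NormedSpace ℝ Y] [FiniteDimensional ℝ Y]

theorem CentreStable.exists_invariant_graph {L : X × Y →L[ℝ] X × Y} {η K ε K' : ℝ}
    {F : X × Y → X × Y} (hη : 0 ≤ η) (h₁ : CentreStable L η K) (h₂ : CentreStable L (2 * η) K)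
    (hK : 0 ≤ K) (hε : 0 ≤ ε) (hKε : K * ε ≤ 1 / 2) (hF : ContDiff ℝ 2 F) (hF0 : F 0 = 0)
    (hdF0 : fderiv ℝ F 0 = 0) (hlip : ∀ u v, ‖F u - F v‖ ≤ ε * ‖u - v‖)
    (hF' : ∀ u v, ‖F v - F u - fderiv ℝ F u (v - u)‖ ≤ K' * ‖v - u‖ ^ 2) :
    ∃ h : X → Y, ContDiff ℝ 1 h ∧ h 0 = 0 ∧ fderiv ℝ h 0 = 0 ∧
      ∀ ξ, ∃ u : ℝ → X × Y, (∀ t, HasDerivAt u (L (u t) + F (u t)) t) ∧ u 0 = (ξ, h ξ) ∧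
        ∀ t, (u t).2 = h (u t).1 := by
  have : CompleteSpace X := FiniteDimensional.complete ℝ X
  have : CompleteSpace Y := FiniteDimensional.complete ℝ Y
  have hFle : ∀ u, ‖F u‖ ≤ ε * ‖u‖ := fun u => by simpa [hF0] using hlip u 0
  have hdF : ∀ u, ‖fderiv ℝ F u‖ ≤ ε := fun u => by
    have := norm_fderiv_le_of_lipschitz ℝ (x₀ := u) (LipschitzWith.of_dist_le_mul
      (K := Real.toNNReal ε) (f := F) fun u v => by
        rw [dist_eq_norm, dist_eq_norm, Real.coe_toNNReal _ hε]; exact hlip u v)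
    rwa [Real.coe_toNNReal _ hε] at this
  have hdFc : Continuous (fderiv ℝ F) := hF.continuous_fderiv two_ne_zero
  choose u N hu huN hu0 using fun ξ : X => h₁.exists_solution hK hε hKε (Φ := fun _ => F)
    (hF.continuous.comp continuous_snd) (fun _ => hlip) (fun _ => hF0) ξ
  have huc : ∀ ξ, Continuous (u ξ) := fun ξ =>
    continuous_iff_continuousAt.2 fun t => (hu ξ t).continuousAt
  have huniq : ∀ (v : ℝ → X × Y) (N' : ℝ), (∀ t, HasDerivAt v (L (v t) + F (v t)) t) →
      (∀ t, ‖v t‖ ≤ N' * Real.exp (η * |t|)) → v 0 = u (v 0).1 0 := fun v N' hv hvN => by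
    refine sub_eq_zero.1 (h₁.eq_zero_of_norm_le hK hε hKε (u := fun t => v t - u (v 0).1 t)
      (p := fun t => F (v t) - F (u (v 0).1 t)) (N := N' + N (v 0).1)
      (fun t => ((hv t).sub (hu _ t)).congr_deriv (by rw [map_sub]; abel)) (fun t => ?_)
      (fun t => hlip _ _) (by simp [hu0]) 0)
    rw [add_mul]
    exact (norm_sub_le _ _).trans (add_le_add (hvN t) (huN _ t))
  have hulip : ∀ ξ ζ t, ‖u ξ t - u ζ t‖ ≤ 2 * K * ‖ξ - ζ‖ * Real.exp (η * |t|) := fun ξ ζ t => by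
    have := h₁.norm_le_of_norm_le_add hK hε hKε (u := fun t => u ξ t - u ζ t)
      (p := fun t => F (u ξ t) - F (u ζ t)) (N := N ξ + N ζ) (M := 0)
      (fun t => ((hu ξ t).sub (hu ζ t)).congr_deriv (by rw [map_sub]; abel))
      (fun t => by
        rw [add_mul]
        exact (norm_sub_le _ _).trans (add_le_add (huN ξ t) (huN ζ t)))
      (fun t => by simpa using hlip _ _) t
    simpa [hu0] using this
  choose w N' hw hwN hw0 using fun ζ v : X => h₁.exists_solution hK hε hKε
    (Φ := fun t z => fderiv ℝ F (u ζ t) z)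
    ((hdFc.comp ((huc ζ).comp continuous_fst)).clm_apply continuous_snd)
    (fun t z z' => by
      rw [← map_sub]
      exact (ContinuousLinearMap.le_opNorm _ _).trans (by gcongr; exact hdF _))
    (fun t => map_zero _) v
  have hwuniq : ∀ ζ (z : ℝ → X × Y) (N₀ : ℝ),
      (∀ t, HasDerivAt z (L (z t) + fderiv ℝ F (u ζ t) (z t)) t) →
      (∀ t, ‖z t‖ ≤ N₀ * Real.exp (η * |t|)) → z 0 = w ζ (z 0).1 0 := fun ζ z N₀ hz hzN => by
    refine sub_eq_zero.1 (h₁.eq_zero_of_norm_le hK hε hKε (u := fun t => z t - w ζ (z 0).1 t)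
      (p := fun t => fderiv ℝ F (u ζ t) (z t - w ζ (z 0).1 t)) (N := N₀ + N' ζ (z 0).1)
      (fun t => ((hz t).sub (hw _ _ t)).congr_deriv (by rw [map_sub, map_sub]; abel)) (fun t => ?_)
      (fun t => (ContinuousLinearMap.le_opNorm _ _).trans (by gcongr; exact hdF _))
      (by simp [hw0]) 0)
    rw [add_mul]
    exact (norm_sub_le _ _).trans (add_le_add (hzN t) (hwN _ _ t))
  let D : X → X →L[ℝ] Y := fun ζ => LinearMap.toContinuousLinearMap
    { toFun := fun v => (w ζ v 0).2
      map_add' := fun v v' => by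
        have := hwuniq ζ (fun t => w ζ v t + w ζ v' t) (N' ζ v + N' ζ v')
          (fun t => ((hw ζ v t).add (hw ζ v' t)).congr_deriv (by rw [map_add, map_add]; abel))
          (fun t => by
            rw [add_mul]
            exact (norm_add_le _ _).trans (add_le_add (hwN _ _ t) (hwN _ _ t)))
        simp only [Prod.fst_add, hw0] at this
        rw [← this, Prod.snd_add]
      map_smul' := fun c v => by
        have := hwuniq ζ (fun t => c • w ζ v t) (‖c‖ * N' ζ v)
          (fun t => ((hw ζ v t).const_smul c).congr_deriv (by rw [map_smul, map_smul, smul_add]))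
          (fun t => by
            rw [norm_smul, mul_assoc]
            gcongr
            exact hwN _ _ t)
        simp only [Prod.smul_fst, hw0] at this
        rw [← this, Prod.smul_snd, RingHom.id_apply] }
  have hD : ∀ ζ v, D ζ v = (w ζ v 0).2 := fun _ _ => rfl
  have htaylor : ∀ ζ ξ, ‖(u ξ 0).2 - (u ζ 0).2 - D ζ (ξ - ζ)‖
      ≤ 2 * K * (|K'| * (2 * K) ^ 2) * ‖ξ - ζ‖ ^ 2 := fun ζ ξ => by
    have hexp : ∀ t : ℝ, Real.exp (η * |t|) ^ 2 = Real.exp (2 * η * |t|) := fun t => by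
      rw [← Real.exp_nat_mul]; push_cast; ring_nf
    have h := h₂.norm_le_of_norm_le_add hK hε hKε
      (u := fun t => u ξ t - u ζ t - w ζ (ξ - ζ) t)
      (p := fun t => F (u ξ t) - F (u ζ t) - fderiv ℝ F (u ζ t) (w ζ (ξ - ζ) t))
      (N := |N ξ + N ζ + N' ζ (ξ - ζ)|) (M := |K'| * (2 * K * ‖ξ - ζ‖) ^ 2)
      (fun t => (((hu ξ t).sub (hu ζ t)).sub (hw ζ _ t)).congr_deriv
        (by rw [map_sub, map_sub]; abel))
      (fun t => by
        calc _ ≤ (N ξ + N ζ + N' ζ (ξ - ζ)) * Real.exp (η * |t|) := by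
              rw [add_mul, add_mul]
              exact (norm_sub_le _ _).trans (add_le_add ((norm_sub_le _ _).trans
                (add_le_add (huN ξ t) (huN ζ t))) (hwN _ _ t))
          _ ≤ |N ξ + N ζ + N' ζ (ξ - ζ)| * Real.exp (2 * η * |t|) := by
              gcongr
              · exact le_abs_self _
              · linarith)
      (fun t => by
        have e : F (u ξ t) - F (u ζ t) - fderiv ℝ F (u ζ t) (w ζ (ξ - ζ) t)
            = fderiv ℝ F (u ζ t) (u ξ t - u ζ t - w ζ (ξ - ζ) t)
              + (F (u ξ t) - F (u ζ t) - fderiv ℝ F (u ζ t) (u ξ t - u ζ t)) := by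
          rw [map_sub (fderiv ℝ F (u ζ t)) (u ξ t - u ζ t)]; abel
        rw [e]
        refine (norm_add_le _ _).trans (add_le_add ?_ ?_)
        · exact (ContinuousLinearMap.le_opNorm _ _).trans (by gcongr; exact hdF _)
        · calc _ ≤ K' * ‖u ξ t - u ζ t‖ ^ 2 := hF' _ _
            _ ≤ |K'| * (2 * K * ‖ξ - ζ‖ * Real.exp (η * |t|)) ^ 2 := by
              gcongr
              · exact le_abs_self _
              · exact hulip ξ ζ t
            _ = _ := by rw [mul_pow, hexp]; ring) 0
    simp only [Prod.fst_sub, hu0, hw0, sub_self, norm_zero, zero_add, abs_zero, mul_zero,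
      Real.exp_zero, mul_one] at h
    rw [hD]
    refine (norm_snd_le (u ξ 0 - u ζ 0 - w ζ (ξ - ζ) 0)).trans (h.trans (le_of_eq (by ring)))
  obtain ⟨hC1, hfd⟩ := contDiff_one_of_norm_sub_sub_le_sq (h := fun ξ => (u ξ 0).2) htaylor
  have hu00 : u 0 = 0 := funext fun t =>
    h₁.eq_zero_of_norm_le hK hε hKε (hu 0) (huN 0) (fun t => hFle _) (hu0 0) t
  refine ⟨fun ξ => (u ξ 0).2, hC1, by simp [hu00], ?_, fun ξ => ⟨u ξ, hu ξ, ?_, fun t => ?_⟩⟩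
  · rw [hfd]
    ext v
    have := (h₁.bound (w 0 v) (fun _ => 0) (N' 0 v) 0
      (fun t => (hw 0 v t).congr_deriv (by simp [hu00, hdF0])) (hwN 0 v) (fun t => by simp) 0).2
    simpa [hD] using this
  · exact Prod.ext (hu0 ξ) rfl
  · have := huniq (fun s => u ξ (s + t)) (|N ξ| * Real.exp (η * |t|))
      (fun s => (hu ξ (s + t)).comp_add_const s t) (fun s => by
        calc _ ≤ N ξ * Real.exp (η * |s + t|) := huN ξ _
          _ ≤ |N ξ| * Real.exp (η * (|t| + |s|)) := by
            gcongr
            · exact le_abs_self _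
            · rw [add_comm]; exact abs_add_le _ _
          _ = _ := by rw [mul_add, Real.exp_add, mul_assoc])
    simp only [zero_add] at this
    exact congrArg Prod.snd this

end Manifold

theorem eqOn_of_hasDerivAt_of_lipschitzWith {E : Type*} [NormedAddCommGroup E] [NormedSpace ℝ E]
    {v : E → E} {κ : NNReal} (hv : LipschitzWith κ v) {I : Set ℝ} (hI : I.OrdConnected)
    {f g : ℝ → E} (hf : ∀ t ∈ I, HasDerivAt f (v (f t)) t)
    (hg : ∀ t ∈ I, HasDerivAt g (v (g t)) t) {t₀ : ℝ} (ht₀ : t₀ ∈ I) (h : f t₀ = g t₀) :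
    EqOn f g I := by
  intro t ht
  rcases le_total t₀ t with hle | hle
  · have hs := hI.out ht₀ ht
    exact ODE_solution_unique_of_mem_Icc_right (v := fun _ => v) (s := fun _ => univ)
      (fun _ _ => hv.lipschitzOnWith)
      (fun r hr => (hf r (hs hr)).continuousAt.continuousWithinAt)
      (fun r hr => (hf r (hs (Ico_subset_Icc_self hr))).hasDerivWithinAt) (fun _ _ => mem_univ _)
      (fun r hr => (hg r (hs hr)).continuousAt.continuousWithinAt)
      (fun r hr => (hg r (hs (Ico_subset_Icc_self hr))).hasDerivWithinAt) (fun _ _ => mem_univ _)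
      h (right_mem_Icc.2 hle)
  · have hs := hI.out ht ht₀
    exact ODE_solution_unique_of_mem_Icc_left (v := fun _ => v) (s := fun _ => univ)
      (fun _ _ => hv.lipschitzOnWith)
      (fun r hr => (hf r (hs hr)).continuousAt.continuousWithinAt)
      (fun r hr => (hf r (hs (Ioc_subset_Icc_self hr))).hasDerivWithinAt) (fun _ _ => mem_univ _)
      (fun r hr => (hg r (hs hr)).continuousAt.continuousWithinAt)
      (fun r hr => (hg r (hs (Ioc_subset_Icc_self hr))).hasDerivWithinAt) (fun _ _ => mem_univ _)
      h (left_mem_Icc.2 hle)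

theorem mem_roots_charpoly_map_iff {n : ℕ} (M : Matrix (Fin n) (Fin n) ℝ) (μ : ℂ) :
    μ ∈ (M.charpoly.map (algebraMap ℝ ℂ)).roots ↔
      (scalar (Fin n) μ - M.map (algebraMap ℝ ℂ)).det = 0 := by
  rw [← Matrix.charpoly_map, mem_roots (Matrix.charpoly_monic _).ne_zero, IsRoot.def,
    Matrix.eval_charpoly]

theorem neg_mem_roots_charpoly_map_of_neg {n : ℕ} {M : Matrix (Fin n) (Fin n) ℝ} {μ : ℂ}
    (hμ : μ ∈ ((-M).charpoly.map (algebraMap ℝ ℂ)).roots) :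
    -μ ∈ (M.charpoly.map (algebraMap ℝ ℂ)).roots := by
  rw [mem_roots_charpoly_map_iff] at hμ ⊢
  have : scalar (Fin n) (-μ) - M.map (algebraMap ℝ ℂ)
      = -(scalar (Fin n) μ - (-M).map (algebraMap ℝ ℂ)) := by
    rw [map_neg, Matrix.map_neg _ (map_neg _)]
    abel
  rw [this, det_neg, hμ, mul_zero]

theorem exists_norm_exp_mulVecLin_le_abs {n : ℕ} (M : Matrix (Fin n) (Fin n) ℝ)
    (hM : ∀ μ ∈ (M.charpoly.map (algebraMap ℝ ℂ)).roots, μ.re = 0) {a : ℝ} (ha : 0 < a) :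
    ∃ C : ℝ, ∀ τ : ℝ, ‖NormedSpace.exp (τ • M.mulVecLin.toContinuousLinearMap)‖
      ≤ C * Real.exp (a * |τ|) := by
  obtain ⟨C₁, h₁⟩ := exists_norm_exp_mulVecLin_le M (b := a) fun μ hμ => by rwa [hM μ hμ]
  obtain ⟨C₂, h₂⟩ := exists_norm_exp_mulVecLin_le (-M) (b := a) fun μ hμ => by
    have := hM _ (neg_mem_roots_charpoly_map_of_neg hμ)
    rw [Complex.neg_re] at this
    linarith
  refine ⟨max C₁ C₂, fun τ => ?_⟩
  rcases le_total 0 τ with hτ | hτ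
  · rw [abs_of_nonneg hτ]
    exact (h₁ τ hτ).trans (by gcongr; exact le_max_left _ _)
  · have h := h₂ (-τ) (neg_nonneg.2 hτ)
    have e : (-M).mulVecLin.toContinuousLinearMap = -M.mulVecLin.toContinuousLinearMap := by
      ext v i
      simp
    rw [e, neg_smul_neg] at h
    rw [abs_of_nonpos hτ]
    exact h.trans (by gcongr; exact le_max_right _ _)

theorem exists_pos_forall_re_lt_neg (S : Multiset ℂ) (hS : ∀ μ ∈ S, μ.re < 0) :
    ∃ β > (0 : ℝ), ∀ μ ∈ S, μ.re < -β := by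
  induction S using Multiset.induction_on with
  | empty => exact ⟨1, one_pos, by simp⟩
  | cons z S ih =>
    obtain ⟨β, hβ, h⟩ := ih fun μ hμ => hS μ (Multiset.mem_cons_of_mem hμ)
    have hz := hS z (Multiset.mem_cons_self z S)
    refine ⟨min β (-z.re / 2), lt_min hβ (by linarith), fun μ hμ => ?_⟩
    rcases Multiset.mem_cons.1 hμ with rfl | hμ
    · linarith [min_le_right β (-μ.re / 2)]
    · linarith [h μ hμ, min_le_left β (-z.re / 2)]

theorem exists_centreStable_mulVecLin {m s : ℕ} (A : Matrix (Fin m) (Fin m) ℝ)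
    (B : Matrix (Fin s) (Fin s) ℝ)
    (hA : ∀ μ ∈ (A.charpoly.map (algebraMap ℝ ℂ)).roots, μ.re = 0)
    (hB : ∀ μ ∈ (B.charpoly.map (algebraMap ℝ ℂ)).roots, μ.re < 0) :
    ∃ η K : ℝ, 0 ≤ η ∧ 0 ≤ K ∧
      CentreStable (A.mulVecLin.toContinuousLinearMap.prodMap
        B.mulVecLin.toContinuousLinearMap) η K ∧
      CentreStable (A.mulVecLin.toContinuousLinearMap.prodMap
        B.mulVecLin.toContinuousLinearMap) (2 * η) K := by
  obtain ⟨β, hβ, hB'⟩ := exists_pos_forall_re_lt_neg _ hB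
  obtain ⟨D, hD⟩ := exists_norm_exp_mulVecLin_le B hB'
  obtain ⟨C, hC⟩ := exists_norm_exp_mulVecLin_le_abs A hA (a := β / 8) (by linarith)
  have hC0 : 0 ≤ C := by simpa using (norm_nonneg _).trans (hC 0)
  have hD0 : 0 ≤ D := by simpa using (norm_nonneg _).trans (hD 0 le_rfl)
  have h₁ : 0 ≤ C / (β / 4 - β / 8) := div_nonneg hC0 (by linarith)
  have h₂ : 0 ≤ C / (2 * (β / 4) - β / 8) := div_nonneg hC0 (by linarith)
  have h₃ : 0 ≤ D / (β - β / 4) := div_nonneg hD0 (by linarith)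
  have h₄ : 0 ≤ D / (β - 2 * (β / 4)) := div_nonneg hD0 (by linarith)
  refine ⟨β / 4, C + C / (β / 4 - β / 8) + C / (2 * (β / 4) - β / 8) + D / (β - β / 4)
    + D / (β - 2 * (β / 4)), by linarith, by linarith, ?_, ?_⟩ <;>
  exact centreStable_prodMap _ _ hC hD (by linarith) (by linarith) (by linarith) (by linarith)
    (by linarith) (by linarith)

end CentreManifold

/-- Existence of a centre manifold for `ẋ = Ax + f(x,y)`, `ẏ = By + g(x,y)`,
where all eigenvalues of `A` have zero real part, all eigenvalues of `B` have
negative real part, and `f, g` are `C²` and vanish together with their first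
derivatives at the origin: there are `δ > 0` and a `C¹` function `h` with
`h 0 = 0` and `Dh 0 = 0` whose graph is locally invariant under the flow. -/
theorem centre_manifold_existence
    (m s : ℕ)
    (A : Matrix (Fin m) (Fin m) ℝ) (B : Matrix (Fin s) (Fin s) ℝ)
    (f : (Fin m → ℝ) × (Fin s → ℝ) → (Fin m → ℝ))
    (g : (Fin m → ℝ) × (Fin s → ℝ) → (Fin s → ℝ))
    (hf : ContDiff ℝ 2 f) (hg : ContDiff ℝ 2 g)
    (hf0 : f 0 = 0) (hg0 : g 0 = 0)
    (hdf0 : fderiv ℝ f 0 = 0) (hdg0 : fderiv ℝ g 0 = 0)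
    (hA : ∀ μ ∈ (A.charpoly.map (algebraMap ℝ ℂ)).roots, μ.re = 0)
    (hB : ∀ μ ∈ (B.charpoly.map (algebraMap ℝ ℂ)).roots, μ.re < 0) :
    ∃ δ > (0 : ℝ), ∃ h : (Fin m → ℝ) → (Fin s → ℝ),
      ContDiff ℝ 1 h ∧ h 0 = 0 ∧ fderiv ℝ h 0 = 0 ∧
      ∀ (I : Set ℝ) (x : ℝ → Fin m → ℝ) (y : ℝ → Fin s → ℝ),
        I.OrdConnected →
        (∀ t ∈ I, HasDerivAt x (A.mulVec (x t) + f (x t, y t)) t) →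
        (∀ t ∈ I, HasDerivAt y (B.mulVec (y t) + g (x t, y t)) t) →
        (∀ t ∈ I, ‖x t‖ < δ ∧ ‖y t‖ < δ) →
        ∀ t₀ ∈ I, y t₀ = h (x t₀) →
        ∀ t ∈ I, y t = h (x t) := by
  obtain ⟨η, K, hη, hK, h₁, h₂⟩ := CentreManifold.exists_centreStable_mulVecLin A B hA hB
  have hF : ContDiff ℝ 2 fun z => (f z, g z) := hf.prodMk hg
  have hdF : fderiv ℝ (fun z => (f z, g z)) 0 = 0 := by
    rw [DifferentiableAt.fderiv_prodMk (hf.differentiable two_ne_zero 0)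
      (hg.differentiable two_ne_zero 0), hdf0, hdg0]
    rfl
  have hε : 0 < 1 / (2 * (K + 1)) := by positivity
  have hKε : K * (1 / (2 * (K + 1))) ≤ 1 / 2 := by
    rw [mul_one_div, div_le_div_iff₀ (by positivity) two_pos]
    linarith
  obtain ⟨δ, hδ, H, K', hHF, hH, hH0, hdH0, hlip, hH'⟩ :=
    CentreManifold.exists_cutoff hF (by simp [hf0, hg0]) hdF hε
  obtain ⟨h, hh, hh0, hdh0, hinv⟩ :=
    h₁.exists_invariant_graph hη h₂ hK hε.le hKε hH hH0 hdH0 hlip hH'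
  refine ⟨δ, hδ, h, hh, hh0, hdh0, fun I x y hI hx hy hxy t₀ ht₀ hyh t ht => ?_⟩
  obtain ⟨u, hu, hu0, hgraph⟩ := hinv (x t₀)
  set L := A.mulVecLin.toContinuousLinearMap.prodMap B.mulVecLin.toContinuousLinearMap with hL
  have hHlip : LipschitzWith (Real.toNNReal (1 / (2 * (K + 1)))) H :=
    LipschitzWith.of_dist_le_mul fun u v => by
      rw [dist_eq_norm, dist_eq_norm, Real.coe_toNNReal _ hε.le]
      exact hlip u v
  have heq := CentreManifold.eqOn_of_hasDerivAt_of_lipschitzWith (L.lipschitz.add hHlip) hI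
    (f := fun r => (x r, y r)) (g := fun r => u (r - t₀))
    (fun r hr => ((hx r hr).prodMk (hy r hr)).congr_deriv (by
      rw [hHF (x r, y r) (max_lt (hxy r hr).1 (hxy r hr).2)]
      rfl))
    (fun r _ => (hu (r - t₀)).comp_sub_const r t₀) ht₀ (by simp [hu0, hyh]) ht
  have := hgraph (t - t₀)
  rwa [← show (x t, y t) = u (t - t₀) from heq] at this
end

section
/- Relevance of the centre manifold: there exist a radius δ > 0 and a rate γ' > 0 such that for every solution (x(t), y(t)) of the full system defined for all t ≥ 0 with |x(t)| < δ and |y(t)| < δ for all t ≥ 0, there exist a solution s(t) of the reduced m-dimensional system ṡ = A s + f(s, h(s)) and a constant C ≥ 0 with ‖x(t) − s(t)‖ + ‖y(t) − h(s(t))‖ ≤ C e^{−γ' t} for all t ≥ 0; that is, every solution staying near the origin tends exponentially to some solution on the centre manifold. -/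
open Matrix Polynomial Filter

open scoped Topology

section ExpBound

/-- A vector annihilated by a power of `T - μ` grows under `exp (tT)` at most like any
exponential of rate exceeding `re μ`. -/
theorem exists_norm_exp_smul_apply_le_of_pow_sub_smul_one_apply_eq_zero
    {V : Type*} [NormedAddCommGroup V] [NormedSpace ℂ V] [CompleteSpace V]
    (T : V →L[ℂ] V) {μ : ℂ} {k : ℕ} {v : V} (hv : ((T - μ • 1) ^ k) v = 0)
    {κ : ℝ} (hμ : μ.re < κ) :
    ∃ C : ℝ, ∀ t : ℝ, 0 ≤ t →
      ‖NormedSpace.exp ((t : ℂ) • T) v‖ ≤ C * Real.exp (κ * t) := by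
  set N : V →L[ℂ] V := T - μ • 1 with hN
  have hvan : ∀ j, k ≤ j → (N ^ j) v = 0 := by
    intro j hj
    obtain ⟨i, rfl⟩ := Nat.exists_eq_add_of_le' hj
    rw [pow_add, mul_apply_eq_comp, hv, map_zero]
  set c : ℝ := κ - μ.re with hc
  have hc0 : 0 < c := sub_pos.2 hμ
  let _ : NormedAlgebra ℚ (V →L[ℂ] V) := NormedAlgebra.restrictScalars ℚ ℂ _
  refine ⟨∑ j ∈ Finset.range k, (c ^ j)⁻¹ * ‖(N ^ j) v‖, fun t ht => ?_⟩
  have hsplit : (t : ℂ) • T = algebraMap ℂ (V →L[ℂ] V) (t * μ) + (t : ℂ) • N := by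
    rw [Algebra.algebraMap_eq_smul_one, hN, smul_sub, smul_smul]
    abel
  have hsum : NormedSpace.exp ((t : ℂ) • N) v
      = ∑ j ∈ Finset.range k, ((j.factorial : ℂ)⁻¹ * (t : ℂ) ^ j) • (N ^ j) v := by
    have h1 := (NormedSpace.exp_series_hasSum_exp' (𝕂 := ℂ) ((t : ℂ) • N)).mapL
      (ContinuousLinearMap.apply ℂ V v)
    have h2 : HasSum (fun j : ℕ => ((j.factorial : ℂ)⁻¹ * (t : ℂ) ^ j) • (N ^ j) v)
        (NormedSpace.exp ((t : ℂ) • N) v) := by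
      simpa only [_root_.smul_pow, ContinuousLinearMap.apply_apply, _root_.smul_apply,
        mul_smul] using h1
    refine h2.unique (hasSum_sum_of_ne_finset_zero fun j hj => ?_)
    rw [hvan j (by simpa using hj), smul_zero]
  rw [hsplit, NormedSpace.exp_add_of_commute (Algebra.commutes _ _),
    ← NormedSpace.algebraMap_exp_comm, mul_apply_eq_comp, hsum,
    Algebra.algebraMap_eq_smul_one, _root_.smul_apply,
    one_apply_eq_self, norm_smul, ← Complex.exp_eq_exp_ℂ, Complex.norm_exp,
    Complex.re_ofReal_mul]
  have hbound : ‖∑ j ∈ Finset.range k, ((j.factorial : ℂ)⁻¹ * (t : ℂ) ^ j) • (N ^ j) v‖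
      ≤ (∑ j ∈ Finset.range k, (c ^ j)⁻¹ * ‖(N ^ j) v‖) * Real.exp (c * t) := by
    rw [Finset.sum_mul]
    refine norm_sum_le_of_le _ fun j _ => ?_
    have h3 := Real.pow_div_factorial_le_exp (c * t) (by positivity) j
    rw [norm_smul, norm_mul, norm_inv, norm_pow, Complex.norm_real, Real.norm_of_nonneg ht,
      Complex.norm_natCast]
    calc (j.factorial : ℝ)⁻¹ * t ^ j * ‖(N ^ j) v‖
        = (c ^ j)⁻¹ * ‖(N ^ j) v‖ * ((c * t) ^ j / j.factorial) := by
          rw [_root_.mul_pow]; field_simp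
      _ ≤ _ := by gcongr
  calc _ ≤ Real.exp (t * μ.re) * ((∑ j ∈ Finset.range k, (c ^ j)⁻¹ * ‖(N ^ j) v‖)
            * Real.exp (c * t)) := by gcongr
    _ = (∑ j ∈ Finset.range k, (c ^ j)⁻¹ * ‖(N ^ j) v‖)
          * (Real.exp (t * μ.re) * Real.exp (c * t)) := by ring
    _ = _ := by rw [← Real.exp_add, hc]; ring_nf

/-- Orbits of `exp (tT)` grow at most like `exp (κt)` when `κ` exceeds the real parts of all
eigenvalues of `T`. -/
theorem exists_norm_exp_smul_apply_le_of_spectrum_re_lt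
    {V : Type*} [NormedAddCommGroup V] [NormedSpace ℂ V] [FiniteDimensional ℂ V]
    (T : V →L[ℂ] V) {κ : ℝ} (hT : ∀ μ ∈ spectrum ℂ (T : Module.End ℂ V), μ.re < κ) (v : V) :
    ∃ C : ℝ, ∀ t : ℝ, 0 ≤ t →
      ‖NormedSpace.exp ((t : ℂ) • T) v‖ ≤ C * Real.exp (κ * t) := by
  have : CompleteSpace V := FiniteDimensional.complete ℂ V
  have hv : v ∈ ⨆ μ, Module.End.maxGenEigenspace (T : Module.End ℂ V) μ := by
    rw [Module.End.iSup_maxGenEigenspace_eq_top]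
    trivial
  refine Submodule.iSup_induction _ (motive := fun w => ∃ C : ℝ, ∀ t : ℝ, 0 ≤ t →
    ‖NormedSpace.exp ((t : ℂ) • T) w‖ ≤ C * Real.exp (κ * t)) hv ?_ ⟨0, by simp⟩ ?_
  · intro μ w hw
    obtain ⟨k, hk⟩ := (Module.End.mem_maxGenEigenspace _ _ _).1 hw
    by_cases hμ : μ ∈ spectrum ℂ (T : Module.End ℂ V)
    · refine exists_norm_exp_smul_apply_le_of_pow_sub_smul_one_apply_eq_zero T (k := k)
        ?_ (hT μ hμ)
      have : (((T - μ • 1) ^ k : V →L[ℂ] V) : Module.End ℂ V)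
          = ((T : Module.End ℂ V) - μ • 1) ^ k := by
        rw [ContinuousLinearMap.toLinearMap_pow]; rfl
      rw [← ContinuousLinearMap.coe_coe, this, hk]
    · have hu : IsUnit ((T : Module.End ℂ V) - μ • 1) := by
        rw [spectrum.notMem_iff, Algebra.algebraMap_eq_smul_one] at hμ
        simpa using hμ.neg
      have hinj := ((Module.End.isUnit_iff _).1 (hu.pow k)).injective
      have : w = 0 := hinj (by rw [hk, map_zero])
      exact ⟨0, by simp [this]⟩
  · rintro w₁ w₂ ⟨C₁, h₁⟩ ⟨C₂, h₂⟩
    refine ⟨C₁ + C₂, fun t ht => ?_⟩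
    rw [map_add, add_mul]
    exact norm_add_le_of_le (h₁ t ht) (h₂ t ht)

/-- A real-linear map intertwining `L` and `T` intertwines `exp (tL)` and `exp (tT)`. -/
theorem ContinuousLinearMap.map_exp_smul_apply_of_comm
    {E V : Type*} [NormedAddCommGroup E] [NormedSpace ℝ E] [CompleteSpace E]
    [NormedAddCommGroup V] [NormedSpace ℝ V] [NormedSpace ℂ V] [IsScalarTower ℝ ℂ V]
    [CompleteSpace V] (ι : E →L[ℝ] V) {L : E →L[ℝ] E} {T : V →L[ℂ] V}
    (hcomm : ∀ v, ι (L v) = T (ι v)) (t : ℝ) (v : E) :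
    ι (NormedSpace.exp (t • L) v) = NormedSpace.exp ((t : ℂ) • T) (ι v) := by
  have hpow : ∀ (j : ℕ) v, ι ((L ^ j) v) = (T ^ j) (ι v) := by
    intro j
    induction j with
    | zero => simp
    | succ j ih =>
      intro v
      rw [pow_succ, pow_succ, mul_apply_eq_comp, mul_apply_eq_comp, ih, hcomm]
  have h1 := ((NormedSpace.exp_series_hasSum_exp' (𝕂 := ℝ) (t • L)).mapL
    (ContinuousLinearMap.apply ℝ E v)).mapL ι
  have h2 := (NormedSpace.exp_series_hasSum_exp' (𝕂 := ℂ) ((t : ℂ) • T)).mapL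
    (ContinuousLinearMap.apply ℂ V (ι v))
  refine h1.unique ?_
  rw [ContinuousLinearMap.apply_apply] at h2
  convert h2 using 1
  ext j
  simp only [ContinuousLinearMap.apply_apply, _root_.smul_pow, map_smul, hpow]
  rw [← algebraMap_smul ℂ ((j.factorial : ℝ)⁻¹), ← algebraMap_smul ℂ (t ^ j)]
  simp

/-- The operator norm of `exp (tM)` grows at most like `exp (κt)` when `κ` exceeds the real
parts of all complex eigenvalues of the real matrix `M`. -/
theorem Matrix.exists_norm_exp_smul_toLin'_le {n : ℕ} (M : Matrix (Fin n) (Fin n) ℝ) {κ : ℝ}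
    (hM : ∀ μ ∈ spectrum ℂ (M.map (algebraMap ℝ ℂ)), μ.re < κ) :
    ∃ C : ℝ, 0 < C ∧ ∀ t : ℝ, 0 ≤ t →
      ‖NormedSpace.exp (t • (LinearMap.toContinuousLinearMap (Matrix.toLin' M)))‖
        ≤ C * Real.exp (κ * t) := by
  set L := LinearMap.toContinuousLinearMap (Matrix.toLin' M) with hL
  set T := LinearMap.toContinuousLinearMap (Matrix.toLin' (M.map (algebraMap ℝ ℂ))) with hT
  set ι : (Fin n → ℝ) →L[ℝ] (Fin n → ℂ) :=
    ContinuousLinearMap.pi fun i => Complex.ofRealCLM ∘L ContinuousLinearMap.proj i with hι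
  have hcomm : ∀ v, ι (L v) = T (ι v) := by
    intro v
    ext i
    simp [hι, hL, hT, Matrix.mulVec, dotProduct]
  have hnorm : ∀ v, ‖ι v‖ = ‖v‖ := by
    intro v
    simp only [hι, Pi.norm_def, NNReal.coe_inj]
    congr 1
    ext i
    simp
  have hexp : ∀ (t : ℝ) v,
      ι (NormedSpace.exp (t • L) v) = NormedSpace.exp ((t : ℂ) • T) (ι v) :=
    ContinuousLinearMap.map_exp_smul_apply_of_comm ι hcomm
  have hpt : ∀ v : Fin n → ℝ, ∃ C : ℝ, ∀ t : {t : ℝ // 0 ≤ t},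
      ‖(Real.exp (-(κ * t)) • NormedSpace.exp ((t : ℝ) • L)) v‖ ≤ C := by
    intro v
    obtain ⟨C, hC⟩ := exists_norm_exp_smul_apply_le_of_spectrum_re_lt T
      (κ := κ) (by simpa [hT, Matrix.spectrum_toLin'] using hM) (ι v)
    refine ⟨C, fun t => ?_⟩
    have h1 := hC t t.2
    rw [← hexp, hnorm] at h1
    rw [_root_.smul_apply, norm_smul, Real.norm_of_nonneg (Real.exp_pos _).le,
      Real.exp_neg, inv_mul_le_iff₀ (Real.exp_pos _)]
    linarith
  obtain ⟨C, hC⟩ := banach_steinhaus hpt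
  refine ⟨max C 1, by positivity, fun t ht => ?_⟩
  have h1 := hC ⟨t, ht⟩
  rw [norm_smul, Real.norm_of_nonneg (Real.exp_pos _).le, Real.exp_neg,
    inv_mul_le_iff₀ (Real.exp_pos _)] at h1
  calc _ ≤ _ := h1
    _ = C * Real.exp (κ * t) := mul_comm _ _
    _ ≤ _ := by gcongr; exact le_max_left _ _

end ExpBound

section BoundedSolution

open MeasureTheory Set

open scoped BoundedContinuousFunction

variable {E : Type*} [NormedAddCommGroup E] [NormedSpace ℝ E]

/-- The value at `t` of the solution of `u' = Lu + k` which stays bounded in forward time when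
`exp (τL)` decays as `τ → -∞`. -/
noncomputable def forwardDuhamel (L : E →L[ℝ] E) (k : ℝ → E) (t : ℝ) : E :=
  -∫ s in Ioi t, NormedSpace.exp ((t - s) • L) (k s)

variable {L : E →L[ℝ] E} {C κ N : ℝ}

theorem norm_exp_sub_smul_apply_le
    (hL : ∀ τ ≤ 0, ‖NormedSpace.exp (τ • L)‖ ≤ C * Real.exp (κ * τ))
    {k : ℝ → E} (hkN : ∀ t, ‖k t‖ ≤ N) {t s : ℝ} (hs : t ≤ s) :
    ‖NormedSpace.exp ((t - s) • L) (k s)‖ ≤ C * N * Real.exp (κ * t) * Real.exp (-κ * s) := by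
  have hC := hL (t - s) (by linarith)
  calc _ ≤ C * Real.exp (κ * (t - s)) * N :=
        ContinuousLinearMap.le_of_opNorm_le_of_le _ hC (hkN s)
    _ = C * N * (Real.exp (κ * t) * Real.exp (-κ * s)) := by
        rw [← Real.exp_add]; ring_nf
    _ = _ := by ring

theorem norm_forwardDuhamel_le (hκ : 0 < κ)
    (hL : ∀ τ ≤ 0, ‖NormedSpace.exp (τ • L)‖ ≤ C * Real.exp (κ * τ))
    {k : ℝ → E} (hkN : ∀ t, ‖k t‖ ≤ N) (t : ℝ) :
    ‖forwardDuhamel L k t‖ ≤ C / κ * N := by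
  rw [forwardDuhamel, norm_neg]
  calc _ ≤ ∫ s in Ioi t, C * N * Real.exp (κ * t) * Real.exp (-κ * s) := by
        refine norm_integral_le_of_norm_le
          ((integrableOn_exp_mul_Ioi (neg_neg_of_pos hκ) t).const_mul _) ?_
        refine (ae_restrict_iff' measurableSet_Ioi).2 (ae_of_all _ fun s hs => ?_)
        exact norm_exp_sub_smul_apply_le hL hkN (le_of_lt hs)
    _ = C * N / κ * (Real.exp (κ * t) * Real.exp (-κ * t)) := by
        rw [integral_const_mul, integral_exp_mul_Ioi (neg_neg_of_pos hκ)]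
        field_simp
    _ = C / κ * N := by
        rw [← Real.exp_add]; ring_nf; simp

variable [CompleteSpace E]

theorem continuous_exp_smul_clm (L : E →L[ℝ] E) :
    Continuous fun t : ℝ => NormedSpace.exp (t • L) :=
  continuous_iff_continuousAt.2 fun t => (hasDerivAt_exp_smul_const L t).continuousAt

theorem exp_add_smul_clm_apply (L : E →L[ℝ] E) (a b : ℝ) (v : E) :
    NormedSpace.exp ((a + b) • L) v = NormedSpace.exp (a • L) (NormedSpace.exp (b • L) v) := by
  let _ : NormedAlgebra ℚ (E →L[ℝ] E) := NormedAlgebra.restrictScalars ℚ ℝ _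
  rw [add_smul, NormedSpace.exp_add_of_commute
    (((Commute.refl L).smul_left a).smul_right b), mul_apply_eq_comp]

theorem integrableOn_exp_sub_smul_apply (hκ : 0 < κ)
    (hL : ∀ τ ≤ 0, ‖NormedSpace.exp (τ • L)‖ ≤ C * Real.exp (κ * τ))
    {k : ℝ → E} (hk : Continuous k) (hkN : ∀ t, ‖k t‖ ≤ N) (t : ℝ) :
    IntegrableOn (fun s => NormedSpace.exp ((t - s) • L) (k s)) (Ioi t) := by
  have hcont : Continuous fun s => NormedSpace.exp ((t - s) • L) (k s) :=
    ((continuous_exp_smul_clm L).comp (continuous_const.sub continuous_id)).clm_apply hk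
  refine Integrable.mono'
    ((integrableOn_exp_mul_Ioi (neg_neg_of_pos hκ) t).const_mul (C * N * Real.exp (κ * t)))
    hcont.aestronglyMeasurable ?_
  refine (ae_restrict_iff' measurableSet_Ioi).2 (ae_of_all _ fun s hs => ?_)
  exact norm_exp_sub_smul_apply_le hL hkN (le_of_lt hs)

theorem forwardDuhamel_sub (hκ : 0 < κ)
    (hL : ∀ τ ≤ 0, ‖NormedSpace.exp (τ • L)‖ ≤ C * Real.exp (κ * τ))
    {k₁ k₂ : ℝ → E} {N₁ N₂ : ℝ} (hk₁ : Continuous k₁) (hkN₁ : ∀ t, ‖k₁ t‖ ≤ N₁)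
    (hk₂ : Continuous k₂) (hkN₂ : ∀ t, ‖k₂ t‖ ≤ N₂) (t : ℝ) :
    forwardDuhamel L k₁ t - forwardDuhamel L k₂ t = forwardDuhamel L (fun s => k₁ s - k₂ s) t := by
  simp only [forwardDuhamel, map_sub]
  rw [integral_sub (integrableOn_exp_sub_smul_apply hκ hL hk₁ hkN₁ t)
    (integrableOn_exp_sub_smul_apply hκ hL hk₂ hkN₂ t)]
  abel

theorem hasDerivAt_forwardDuhamel (hκ : 0 < κ)
    (hL : ∀ τ ≤ 0, ‖NormedSpace.exp (τ • L)‖ ≤ C * Real.exp (κ * τ))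
    {k : ℝ → E} (hk : Continuous k) (hkN : ∀ t, ‖k t‖ ≤ N) (t : ℝ) :
    HasDerivAt (forwardDuhamel L k) (L (forwardDuhamel L k t) + k t) t := by
  set q : ℝ → E := fun s => NormedSpace.exp ((-s) • L) (k s) with hq
  have hqc : Continuous q :=
    ((continuous_exp_smul_clm L).comp continuous_neg).clm_apply hk
  have hcancel : ∀ (r : ℝ) v,
      NormedSpace.exp (r • L) (NormedSpace.exp ((-r) • L) v) = v := by
    intro r v
    rw [← exp_add_smul_clm_apply, add_neg_cancel, zero_smul, NormedSpace.exp_zero,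
      one_apply_eq_self]
  have hqi : ∀ r, IntegrableOn q (Ioi r) := by
    intro r
    have h1 := (NormedSpace.exp ((-r) • L)).integrable_comp
      (integrableOn_exp_sub_smul_apply hκ hL hk hkN r)
    refine h1.congr (ae_of_all _ fun s => ?_)
    simp only [hq, ← exp_add_smul_clm_apply]
    ring_nf
  have hrep : forwardDuhamel L k
      = fun r => NormedSpace.exp (r • L) ((∫ s in (0 : ℝ)..r, q s) - ∫ s in Ioi (0 : ℝ), q s) := by
    ext1 r
    rw [← intervalIntegral.integral_Ioi_sub_Ioi' (hqi 0) (hqi r), sub_sub_cancel_left, map_neg,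
      forwardDuhamel, ← ContinuousLinearMap.integral_comp_comm _ (hqi r)]
    congr 2
    ext1 s
    rw [hq, ← exp_add_smul_clm_apply, sub_eq_add_neg]
  have h1 : HasDerivAt (fun r => (∫ s in (0 : ℝ)..r, q s) - ∫ s in Ioi (0 : ℝ), q s) (q t) t :=
    (intervalIntegral.integral_hasDerivAt_right (hqc.intervalIntegrable _ _)
      hqc.stronglyMeasurable.stronglyMeasurableAtFilter hqc.continuousAt).sub_const _
  have h2 := (hasDerivAt_exp_smul_const' L t).clm_apply h1
  rw [hrep]
  convert h2 using 1
  rw [mul_apply_eq_comp, hq, hcancel]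

/-- If `exp (τL)` decays exponentially as `τ → -∞`, a Lipschitz perturbation of `u' = Lu` with
small Lipschitz constant has a bounded solution. -/
theorem exists_bounded_solution_of_exp_decay {ε M : ℝ} (hC : 0 ≤ C) (hκ : 0 < κ)
    (hL : ∀ τ ≤ 0, ‖NormedSpace.exp (τ • L)‖ ≤ C * Real.exp (κ * τ))
    {H : ℝ → E → E} (hH : Continuous fun p : ℝ × E => H p.1 p.2)
    (hlip : ∀ t p q, ‖H t p - H t q‖ ≤ ε * ‖p - q‖) (hε : 0 ≤ ε)
    (hM : ∀ t, ‖H t 0‖ ≤ M) (hsmall : C / κ * ε ≤ 1 / 2) :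
    ∃ ψ : ℝ → E, (∀ t, ‖ψ t‖ ≤ 2 * (C / κ) * M) ∧
      ∀ t, HasDerivAt ψ (L (ψ t) + H t (ψ t)) t := by
  have hHb : ∀ t p, ‖H t p‖ ≤ ε * ‖p‖ + M := by
    intro t p
    have h1 := hlip t p 0
    rw [sub_zero] at h1
    calc ‖H t p‖ = ‖(H t p - H t 0) + H t 0‖ := by rw [sub_add_cancel]
      _ ≤ _ := norm_add_le_of_le h1 (hM t)
  have hkc : ∀ ψ : ℝ →ᵇ E, Continuous fun t => H t (ψ t) := fun ψ =>
    hH.comp (continuous_id.prodMk ψ.continuous)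
  have hkb : ∀ (ψ : ℝ →ᵇ E) t, ‖H t (ψ t)‖ ≤ ε * ‖ψ‖ + M := fun ψ t =>
    (hHb t _).trans (by gcongr; exact ψ.norm_coe_le_norm t)
  let Φ : (ℝ →ᵇ E) → (ℝ →ᵇ E) := fun ψ =>
    BoundedContinuousFunction.ofNormedAddCommGroup (forwardDuhamel L fun t => H t (ψ t))
      (continuous_iff_continuousAt.2 fun t =>
        (hasDerivAt_forwardDuhamel hκ hL (hkc ψ) (hkb ψ) t).continuousAt)
      (C / κ * (ε * ‖ψ‖ + M)) (norm_forwardDuhamel_le hκ hL (hkb ψ))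
  have hΦ : ContractingWith (1 / 2) Φ := by
    refine ⟨by norm_num [← NNReal.coe_lt_coe], LipschitzWith.of_dist_le_mul fun ψ₁ ψ₂ => ?_⟩
    refine (BoundedContinuousFunction.dist_le (by positivity)).2 fun t => ?_
    rw [dist_eq_norm, dist_eq_norm]
    change ‖forwardDuhamel L _ t - forwardDuhamel L _ t‖ ≤ _
    rw [forwardDuhamel_sub hκ hL (hkc ψ₁) (hkb ψ₁) (hkc ψ₂) (hkb ψ₂)]
    have h1 : ∀ s, ‖H s (ψ₁ s) - H s (ψ₂ s)‖ ≤ ε * ‖ψ₁ - ψ₂‖ := fun s =>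
      (hlip s _ _).trans (by gcongr; exact (ψ₁ - ψ₂).norm_coe_le_norm s)
    calc _ ≤ C / κ * (ε * ‖ψ₁ - ψ₂‖) := norm_forwardDuhamel_le hκ hL h1 t
      _ = C / κ * ε * ‖ψ₁ - ψ₂‖ := by ring
      _ ≤ 1 / 2 * ‖ψ₁ - ψ₂‖ := by gcongr
      _ = _ := by simp
  set ψ := ContractingWith.fixedPoint Φ hΦ with hψ
  have hfix : Φ ψ = ψ := hΦ.fixedPoint_isFixedPt
  have heq : ∀ t, ψ t = forwardDuhamel L (fun s => H s (ψ s)) t := fun t =>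
    (DFunLike.congr_fun hfix t).symm
  refine ⟨ψ, fun t => ?_, fun t => ?_⟩
  · have hM0 : 0 ≤ M := (norm_nonneg _).trans (hM 0)
    have h1 : ‖ψ‖ ≤ C / κ * (ε * ‖ψ‖ + M) := by
      refine (BoundedContinuousFunction.norm_le (by positivity)).2 fun t => ?_
      rw [heq]
      exact norm_forwardDuhamel_le hκ hL (hkb ψ) t
    have h2 : C / κ * ε * ‖ψ‖ ≤ 1 / 2 * ‖ψ‖ := by gcongr
    have h3 := ψ.norm_coe_le_norm t
    linarith
  · have h1 := hasDerivAt_forwardDuhamel hκ hL (hkc ψ) (hkb ψ) t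
    rw [← heq] at h1
    exact h1.congr_of_eventuallyEq (Eventually.of_forall heq)

end BoundedSolution

/-- If `exp (tL)` decays at rate `β`, solutions of `u' = Lu + p` with `‖p‖ ≤ ε ‖u‖` and `ε` small
decay at any prescribed rate `γ < β`. -/
theorem norm_le_exp_of_exp_decay_of_norm_deriv_sub_le
    {E : Type*} [NormedAddCommGroup E] [NormedSpace ℝ E] [CompleteSpace E]
    {L : E →L[ℝ] E} {C β γ ε : ℝ} (hC : 0 ≤ C) (hγ : γ < β)
    (hL : ∀ t, 0 ≤ t → ‖NormedSpace.exp (t • L)‖ ≤ C * Real.exp (-β * t))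
    {u u' : ℝ → E} (hu : ∀ t, 0 ≤ t → HasDerivAt u (u' t) t)
    (hε : 0 ≤ ε) (hpert : ∀ t, 0 ≤ t → ‖u' t - L (u t)‖ ≤ ε * ‖u t‖)
    (hsmall : C * ε / (β - γ) ≤ 1 / 2) {T : ℝ} (hT : 0 ≤ T) :
    ‖u T‖ ≤ 2 * C * ‖u 0‖ * Real.exp (-γ * T) := by
  have hd : 0 < β - γ := sub_pos.2 hγ
  have hcont : ContinuousOn (fun s => Real.exp (γ * s) * ‖u s‖) (Set.Icc 0 T) := fun s hs =>
    ((by fun_prop : Continuous fun s => Real.exp (γ * s)).continuousAt.mul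
      (hu s hs.1).continuousAt.norm).continuousWithinAt
  obtain ⟨τ, ⟨hτ0, hτT⟩, hmax⟩ := isCompact_Icc.exists_isMaxOn ⟨0, by simp [hT]⟩ hcont
  set w : ℝ := Real.exp (γ * τ) * ‖u τ‖ with hw
  have hw0 : 0 ≤ w := by positivity
  have hle : ∀ s ∈ Set.Icc 0 T, ‖u s‖ ≤ w * Real.exp (-γ * s) := by
    intro s hs
    have h1 : Real.exp (γ * s) * ‖u s‖ ≤ w := hmax hs
    rwa [neg_mul, Real.exp_neg, ← div_eq_mul_inv, le_div_iff₀ (Real.exp_pos _), mul_comm]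
  have hderiv : ∀ s, 0 ≤ s → HasDerivAt (fun s => NormedSpace.exp ((τ - s) • L) (u s))
      (NormedSpace.exp ((τ - s) • L) (u' s - L (u s))) s := by
    intro s hs
    have h1 := ((hasDerivAt_exp_smul_const L (τ - s)).comp_const_sub τ s).clm_apply (hu s hs)
    convert h1 using 1
    rw [_root_.neg_apply, mul_apply_eq_comp, map_sub, neg_add_eq_sub]
  have hbd := image_norm_le_of_norm_deriv_right_le_deriv_boundary (a := 0) (b := τ)
    (f := fun s => NormedSpace.exp ((τ - s) • L) (u s))
    (f' := fun s => NormedSpace.exp ((τ - s) • L) (u' s - L (u s)))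
    (B := fun s => C * Real.exp (-β * τ) * ‖u 0‖
      + C * ε / (β - γ) * w * Real.exp (-β * τ) * Real.exp ((β - γ) * s))
    (B' := fun s => C * ε * w * Real.exp (-β * τ) * Real.exp ((β - γ) * s))
    (fun s hs => (hderiv s hs.1).continuousAt.continuousWithinAt)
    (fun s hs => (hderiv s hs.1).hasDerivWithinAt)
    (by
      have h1 := ContinuousLinearMap.le_of_opNorm_le _ (hL τ hτ0) (u 0)
      simp only [sub_zero]
      have h2 : 0 ≤ C * ε / (β - γ) * w * Real.exp (-β * τ) * Real.exp ((β - γ) * 0) := by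
        positivity
      linarith)
    (fun s => by
      have h1 := ((((hasDerivAt_id' s).const_mul (β - γ)).exp).const_mul
        (C * ε / (β - γ) * w * Real.exp (-β * τ))).const_add (C * Real.exp (-β * τ) * ‖u 0‖)
      refine h1.congr_deriv ?_
      field_simp)
    (fun s hs => by
      have h1 := hle s ⟨hs.1, hs.2.le.trans hτT⟩
      calc _ ≤ C * Real.exp (-β * (τ - s)) * (ε * (w * Real.exp (-γ * s))) :=
            ContinuousLinearMap.le_of_opNorm_le_of_le _ (hL _ (by linarith [hs.2]))
              ((hpert s hs.1).trans (by gcongr))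
        _ = C * ε * w * (Real.exp (-β * (τ - s)) * Real.exp (-γ * s)) := by ring
        _ = C * ε * w * (Real.exp (-β * τ) * Real.exp ((β - γ) * s)) := by
            rw [← Real.exp_add, ← Real.exp_add]; ring_nf
        _ = _ := by ring)
    (Set.right_mem_Icc.2 hτ0)
  have hwle : w ≤ 2 * C * ‖u 0‖ := by
    simp only [sub_self, zero_smul, NormedSpace.exp_zero, one_apply_eq_self] at hbd
    have h1 : w ≤ C * ‖u 0‖ * Real.exp (-(β - γ) * τ) + C * ε / (β - γ) * w := by
      calc w ≤ Real.exp (γ * τ) * _ := mul_le_mul_of_nonneg_left hbd (Real.exp_pos _).le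
        _ = C * ‖u 0‖ * (Real.exp (γ * τ) * Real.exp (-β * τ)) + C * ε / (β - γ) * w *
            (Real.exp (γ * τ) * Real.exp (-β * τ) * Real.exp ((β - γ) * τ)) := by ring
        _ = _ := by
          rw [← Real.exp_add, ← Real.exp_add, show γ * τ + -β * τ = -(β - γ) * τ by ring,
            show -(β - γ) * τ + (β - γ) * τ = 0 by ring, Real.exp_zero, mul_one]
    have h2 : Real.exp (-(β - γ) * τ) ≤ 1 := Real.exp_le_one_iff.2 (by nlinarith)
    have h3 : C * ‖u 0‖ * Real.exp (-(β - γ) * τ) ≤ C * ‖u 0‖ * 1 := by gcongr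
    have h4 : C * ε / (β - γ) * w ≤ 1 / 2 * w := by gcongr
    linarith
  exact (hle T ⟨hT, le_rfl⟩).trans (by gcongr)

section CentreManifold

/-- A graph which is locally invariant under the flow is tangent to the vector field. -/
theorem fderiv_apply_eq_of_locally_invariant
    {E F : Type*} [NormedAddCommGroup E] [NormedSpace ℝ E] [CompleteSpace E]
    [NormedAddCommGroup F] [NormedSpace ℝ F] [CompleteSpace F]
    {X : E × F → E} {Y : E × F → F} (hX : ContDiff ℝ 1 X) (hY : ContDiff ℝ 1 Y)
    {h : E → F} (hh : ContDiff ℝ 1 h) {δ₀ : ℝ}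
    (hinv : ∀ (I : Set ℝ) (x : ℝ → E) (y : ℝ → F), I.OrdConnected →
      (∀ t ∈ I, HasDerivAt x (X (x t, y t)) t) →
      (∀ t ∈ I, HasDerivAt y (Y (x t, y t)) t) →
      (∀ t ∈ I, ‖x t‖ < δ₀ ∧ ‖y t‖ < δ₀) →
      ∀ t₀ ∈ I, y t₀ = h (x t₀) → ∀ t ∈ I, y t = h (x t))
    {x₀ : E} (hx₀ : ‖x₀‖ < δ₀) (hhx₀ : ‖h x₀‖ < δ₀) :
    fderiv ℝ h x₀ (X (x₀, h x₀)) = Y (x₀, h x₀) := by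
  obtain ⟨α, hα0, τ, hτ, hα⟩ :=
    ContDiffAt.exists_forall_mem_closedBall_exists_eq_forall_mem_Ioo_hasDerivAt₀
      (f := fun p => (X p, Y p)) (x₀ := (x₀, h x₀)) (hX.prodMk hY).contDiffAt 0
  have h0 : (0 : ℝ) ∈ Set.Ioo (0 - τ) (0 + τ) := ⟨by linarith, by linarith⟩
  have hnear : ∀ᶠ t in 𝓝 (0 : ℝ), ‖(α t).1‖ < δ₀ ∧ ‖(α t).2‖ < δ₀ := by
    have hc := (hα 0 h0).continuousAt
    exact (hc.fst.norm.eventually_lt continuousAt_const (by simpa [hα0])).and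
      (hc.snd.norm.eventually_lt continuousAt_const (by simpa [hα0]))
  obtain ⟨a, b, hab, hIoo⟩ := mem_nhds_iff_exists_Ioo_subset.1
    (inter_mem (Ioo_mem_nhds h0.1 h0.2) hnear)
  have hx : ∀ t ∈ Set.Ioo a b, HasDerivAt (fun t => (α t).1) (X ((α t).1, (α t).2)) t :=
    fun t ht => (hα t (hIoo ht).1).fst
  have hy : ∀ t ∈ Set.Ioo a b, HasDerivAt (fun t => (α t).2) (Y ((α t).1, (α t).2)) t :=
    fun t ht => (hα t (hIoo ht).1).snd
  have hgraph := hinv (Set.Ioo a b) _ _ Set.ordConnected_Ioo hx hy (fun t ht => (hIoo ht).2)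
    0 hab (by simp [hα0])
  have h1 := ((hh.differentiable one_ne_zero (α 0).1).hasFDerivAt.comp_hasDerivAt 0 (hx 0 hab))
  have h2 := h1.congr_of_eventuallyEq
    (Filter.eventuallyEq_of_mem (Ioo_mem_nhds hab.1 hab.2) hgraph)
  simpa [hα0] using h2.unique (hy 0 hab)

/-- A `C¹` map with vanishing derivative at the origin has arbitrarily small derivative and
Lipschitz constant near the origin. -/
theorem ContDiff.exists_ball_norm_fderiv_le_and_norm_sub_le
    {E F : Type*} [NormedAddCommGroup E] [NormedSpace ℝ E]
    [NormedAddCommGroup F] [NormedSpace ℝ F]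
    {f : E → F} (hf : ContDiff ℝ 1 f) (hdf0 : fderiv ℝ f 0 = 0) {ε : ℝ} (hε : 0 < ε) :
    ∃ ρ > (0 : ℝ), (∀ p, ‖p‖ < ρ → ‖fderiv ℝ f p‖ ≤ ε) ∧
      ∀ p q, ‖p‖ < ρ → ‖q‖ < ρ → ‖f p - f q‖ ≤ ε * ‖p - q‖ := by
  have hev : ∀ᶠ p in 𝓝 (0 : E), ‖fderiv ℝ f p‖ < ε :=
    (hf.continuous_fderiv one_ne_zero).norm.continuousAt.eventually_lt continuousAt_const
      (by simpa [hdf0])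
  obtain ⟨ρ, hρ, hball⟩ := Metric.eventually_nhds_iff_ball.1 hev
  have hb : ∀ p, ‖p‖ < ρ → ‖fderiv ℝ f p‖ ≤ ε := fun p hp => (hball p (by simpa using hp)).le
  refine ⟨ρ, hρ, hb, fun p q hp hq => ?_⟩
  exact (convex_ball (0 : E) ρ).norm_image_sub_le_of_norm_fderiv_le
    (fun x _ => hf.differentiable one_ne_zero x) (fun x hx => hb x (by simpa using hx))
    (by simpa using hq) (by simpa using hp)

theorem norm_exp_smul_add_smul_one_le {E : Type*} [NormedAddCommGroup E] [NormedSpace ℝ E]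
    [CompleteSpace E] {L : E →L[ℝ] E} {C κ : ℝ}
    (hL : ∀ τ ≤ 0, ‖NormedSpace.exp (τ • L)‖ ≤ C * Real.exp (κ * τ)) (γ : ℝ) {τ : ℝ} (hτ : τ ≤ 0) :
    ‖NormedSpace.exp (τ • (L + γ • (1 : E →L[ℝ] E)))‖ ≤ C * Real.exp ((κ + γ) * τ) := by
  let _ : NormedAlgebra ℚ (E →L[ℝ] E) := NormedAlgebra.restrictScalars ℚ ℝ _
  have hsplit : τ • (L + γ • (1 : E →L[ℝ] E))
      = algebraMap ℝ (E →L[ℝ] E) (γ * τ) + τ • L := by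
    rw [Algebra.algebraMap_eq_smul_one, smul_add, smul_smul, mul_comm, add_comm]
  rw [hsplit, NormedSpace.exp_add_of_commute (Algebra.commutes _ _),
    ← NormedSpace.algebraMap_exp_comm, ← Algebra.smul_def, norm_smul, ← Real.exp_eq_exp_ℝ,
    Real.norm_of_nonneg (Real.exp_pos _).le, add_mul, Real.exp_add]
  calc _ ≤ Real.exp (γ * τ) * (C * Real.exp (κ * τ)) := by gcongr; exact hL τ hτ
    _ = _ := by ring

theorem continuous_comp_max_zero {G : Type*} [TopologicalSpace G] {w : ℝ → G}
    (hw : ∀ t, 0 ≤ t → ContinuousAt w t) : Continuous fun t => w (max t 0) :=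
  continuous_iff_continuousAt.2 fun t =>
    ContinuousAt.comp (f := fun t => max t 0) (hw _ (le_max_right t 0))
      (by fun_prop : Continuous fun t : ℝ => max t 0).continuousAt

/-- Exponential asymptotic phase: solutions of the full system which stay in a small ball
approach, at an exponential rate, a solution on a centre manifold. -/
theorem exists_exponentially_asymptotic_reduced_solution {m : ℕ}
    {F : Type*} [NormedAddCommGroup F] [NormedSpace ℝ F] [CompleteSpace F]
    {A : (Fin m → ℝ) →L[ℝ] (Fin m → ℝ)} {B : F →L[ℝ] F}
    {f : (Fin m → ℝ) × F → (Fin m → ℝ)} {g : (Fin m → ℝ) × F → F} {h : (Fin m → ℝ) → F}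
    (hf : ContDiff ℝ 1 f) (hg : ContDiff ℝ 1 g) (hh : ContDiff ℝ 1 h)
    (hdf0 : fderiv ℝ f 0 = 0) (hdg0 : fderiv ℝ g 0 = 0)
    (hh0 : h 0 = 0) (hdh0 : fderiv ℝ h 0 = 0)
    {β CA CB : ℝ} (hβ : 0 < β) (hCA : 0 < CA) (hCB : 0 < CB)
    (hA : ∀ τ ≤ 0, ‖NormedSpace.exp (τ • A)‖ ≤ CA * Real.exp (-(β / 4) * τ))
    (hB : ∀ t, 0 ≤ t → ‖NormedSpace.exp (t • B)‖ ≤ CB * Real.exp (-β * t))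
    {δ₀ : ℝ} (hδ₀ : 0 < δ₀)
    (hinv : ∀ x, ‖x‖ < δ₀ → ‖h x‖ < δ₀ →
      fderiv ℝ h x (A x + f (x, h x)) = B (h x) + g (x, h x)) :
    ∃ δ > (0 : ℝ), ∀ (x : ℝ → Fin m → ℝ) (y : ℝ → F),
      (∀ t, 0 ≤ t → HasDerivAt x (A (x t) + f (x t, y t)) t) →
      (∀ t, 0 ≤ t → HasDerivAt y (B (y t) + g (x t, y t)) t) →
      (∀ t, 0 ≤ t → ‖x t‖ < δ ∧ ‖y t‖ < δ) →
      ∃ z : ℝ → Fin m → ℝ,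
        (∀ t, 0 ≤ t → HasDerivAt z (A (z t) + f (z t, h (z t))) t) ∧
        ∃ C : ℝ, 0 ≤ C ∧ ∀ t, 0 ≤ t →
          ‖x t - z t‖ + ‖y t - h (z t)‖ ≤ C * Real.exp (-(β / 2) * t) := by
  obtain ⟨ε, hε, hε1, hεA, hεB⟩ : ∃ ε > (0 : ℝ), ε ≤ 1 ∧
      CA / (β / 4) * ε ≤ 1 / 2 ∧ CB * (2 * ε) / (β - β / 2) ≤ 1 / 2 := by
    refine ⟨min 1 (min (β / (8 * CA)) (β / (8 * CB))), by positivity, min_le_left _ _, ?_, ?_⟩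
    · calc _ ≤ CA / (β / 4) * (β / (8 * CA)) := by
            gcongr; exact (min_le_right _ _).trans (min_le_left _ _)
        _ = 1 / 2 := by field_simp; norm_num
    · rw [sub_half]
      calc _ ≤ CB * (2 * (β / (8 * CB))) / (β / 2) := by
            gcongr; exact (min_le_right _ _).trans (min_le_right _ _)
        _ = 1 / 2 := by field_simp; norm_num
  obtain ⟨ρ₁, hρ₁, -, hfl⟩ := hf.exists_ball_norm_fderiv_le_and_norm_sub_le hdf0 hε
  obtain ⟨ρ₂, hρ₂, -, hgl⟩ := hg.exists_ball_norm_fderiv_le_and_norm_sub_le hdg0 hε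
  obtain ⟨ρ₃, hρ₃, hdh, hhl⟩ := hh.exists_ball_norm_fderiv_le_and_norm_sub_le hdh0 hε
  obtain ⟨ρ, hρ, hρ1, hρ2, hρ3, hρ0⟩ : ∃ ρ > (0 : ℝ), ρ ≤ ρ₁ ∧ ρ ≤ ρ₂ ∧ ρ ≤ ρ₃ ∧ ρ ≤ δ₀ :=
    ⟨min (min ρ₁ ρ₂) (min ρ₃ δ₀), by positivity, by simp, by simp, by simp, by simp⟩
  have hhle : ∀ x, ‖x‖ < ρ → ‖h x‖ ≤ ‖x‖ := by
    intro x hx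
    have h1 := hhl x 0 (hx.trans_le hρ3) (by simpa using hρ₃)
    rw [hh0, sub_zero, sub_zero] at h1
    exact h1.trans (mul_le_of_le_one_left (norm_nonneg _) hε1)
  have hmem : ∀ x, ‖x‖ < ρ → ‖(x, h x)‖ < ρ := fun x hx =>
    max_lt hx ((hhle x hx).trans_lt hx)
  have hredlip : LipschitzOnWith ⟨ε, hε.le⟩ (fun x => f (x, h x)) (Metric.ball 0 ρ) := by
    refine LipschitzOnWith.of_dist_le_mul fun p hp q hq => ?_
    rw [mem_ball_zero_iff] at hp hq
    rw [dist_eq_norm, dist_eq_norm]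
    refine (hfl _ _ ((hmem p hp).trans_le hρ1) ((hmem q hq).trans_le hρ1)).trans ?_
    refine mul_le_mul_of_nonneg_left (max_le le_rfl ?_) hε.le
    exact (hhl p q (hp.trans_le hρ3) (hq.trans_le hρ3)).trans
      (mul_le_of_le_one_left (norm_nonneg _) hε1)
  obtain ⟨R, hRlip, hReq⟩ := hredlip.extend_pi
  have hRnorm : ∀ p q, ‖R p - R q‖ ≤ ε * ‖p - q‖ := fun p q => by
    have h1 := hRlip.dist_le_mul p q
    rw [dist_eq_norm, dist_eq_norm] at h1
    exact h1
  refine ⟨ρ / (1 + 4 * CB), by positivity, fun x y hx hy hxy => ?_⟩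
  set δ := ρ / (1 + 4 * CB) with hδ
  have hδρ : δ + 4 * CB * δ = ρ := by rw [hδ]; field_simp
  have hδ0 : 0 < δ := by positivity
  have hδle : δ ≤ ρ := by nlinarith
  have hxρ : ∀ t, 0 ≤ t → ‖x t‖ < ρ := fun t ht => (hxy t ht).1.trans_le hδle
  have hyρ : ∀ t, 0 ≤ t → ‖(x t, y t)‖ < ρ := fun t ht =>
    max_lt (hxρ t ht) ((hxy t ht).2.trans_le hδle)
  have hpair : ∀ t, ‖(x t, y t) - (x t, h (x t))‖ = ‖y t - h (x t)‖ := fun t => by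
    simp [Prod.norm_def]
  have hfu : ∀ t, 0 ≤ t → ‖f (x t, y t) - f (x t, h (x t))‖ ≤ ε * ‖y t - h (x t)‖ := by
    intro t ht
    rw [← hpair]
    exact hfl _ _ ((hyρ t ht).trans_le hρ1) ((hmem _ (hxρ t ht)).trans_le hρ1)
  have hgu : ∀ t, 0 ≤ t → ‖g (x t, y t) - g (x t, h (x t))‖ ≤ ε * ‖y t - h (x t)‖ := by
    intro t ht
    rw [← hpair]
    exact hgl _ _ ((hyρ t ht).trans_le hρ2) ((hmem _ (hxρ t ht)).trans_le hρ2)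
  have hu0 : ‖y 0 - h (x 0)‖ ≤ 2 * δ := by
    have h1 := hxy 0 le_rfl
    have h2 := hhle _ (hxρ 0 le_rfl)
    linarith [norm_sub_le (y 0) (h (x 0))]
  have hudecay : ∀ t, 0 ≤ t →
      ‖y t - h (x t)‖ ≤ 4 * CB * δ * Real.exp (-(β / 2) * t) := by
    intro t ht
    have h1 := norm_le_exp_of_exp_decay_of_norm_deriv_sub_le hCB.le (half_lt_self hβ) hB
      (u := fun t => y t - h (x t))
      (u' := fun t => B (y t) + g (x t, y t) - fderiv ℝ h (x t) (A (x t) + f (x t, y t)))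
      (fun t ht => (hy t ht).sub
        ((hh.differentiable one_ne_zero (x t)).hasFDerivAt.comp_hasDerivAt t (hx t ht)))
      (by positivity : 0 ≤ 2 * ε)
      (fun t ht => by
        have hi := hinv (x t) ((hxρ t ht).trans_le hρ0)
          (((hhle _ (hxρ t ht)).trans_lt (hxρ t ht)).trans_le hρ0)
        have heq : B (y t) + g (x t, y t) - fderiv ℝ h (x t) (A (x t) + f (x t, y t))
              - B (y t - h (x t))
            = (g (x t, y t) - g (x t, h (x t)))
              - fderiv ℝ h (x t) (f (x t, y t) - f (x t, h (x t))) := by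
          rw [map_add] at hi ⊢
          rw [map_sub, map_sub, eq_sub_of_add_eq hi]
          abel
        rw [heq]
        refine (norm_sub_le_of_le (hgu t ht) (ContinuousLinearMap.le_of_opNorm_le_of_le _
          (hdh _ ((hxρ t ht).trans_le hρ3)) (hfu t ht))).trans ?_
        have h2 : ε * (ε * ‖y t - h (x t)‖) ≤ 1 * (ε * ‖y t - h (x t)‖) := by gcongr
        linarith)
      hεB ht
    refine h1.trans ?_
    calc _ ≤ 2 * CB * (2 * δ) * Real.exp (-(β / 2) * t) := by gcongr
      _ = _ := by ring
  have hxc : Continuous fun t => x (max t 0) := continuous_comp_max_zero fun t ht => (hx t ht).continuousAt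
  have hyc : Continuous fun t => y (max t 0) := continuous_comp_max_zero fun t ht => (hy t ht).continuousAt
  let H : ℝ → (Fin m → ℝ) → (Fin m → ℝ) := fun t p =>
    Real.exp (β / 2 * t) •
        (R (x (max t 0) + Real.exp (-(β / 2) * t) • p) - R (x (max t 0)))
      - Real.exp (β / 2 * max t 0) •
        (f (x (max t 0), y (max t 0)) - f (x (max t 0), h (x (max t 0))))
  have hexp : ∀ t, Real.exp (β / 2 * t) * Real.exp (-(β / 2) * t) = 1 := fun t => by
    rw [← Real.exp_add]; simp
  have hHc : Continuous fun p : ℝ × (Fin m → ℝ) => H p.1 p.2 := by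
    have hRc := hRlip.continuous
    have hfc := hf.continuous
    have hhc := hh.continuous
    have hxc' := hxc.comp (continuous_fst (X := ℝ) (Y := Fin m → ℝ))
    have hyc' := hyc.comp (continuous_fst (X := ℝ) (Y := Fin m → ℝ))
    have he : Continuous fun p : ℝ × (Fin m → ℝ) => Real.exp (β / 2 * p.1) := by fun_prop
    have he' : Continuous fun p : ℝ × (Fin m → ℝ) => Real.exp (-(β / 2) * p.1) := by fun_prop
    have he₀ : Continuous fun p : ℝ × (Fin m → ℝ) => Real.exp (β / 2 * max p.1 0) := by fun_prop
    exact (he.smul ((hRc.comp (hxc'.add (he'.smul continuous_snd))).sub (hRc.comp hxc'))).sub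
      (he₀.smul ((hfc.comp (hxc'.prodMk hyc')).sub (hfc.comp (hxc'.prodMk (hhc.comp hxc')))))
  have hHlip : ∀ t p q, ‖H t p - H t q‖ ≤ ε * ‖p - q‖ := by
    intro t p q
    have h1 : H t p - H t q = Real.exp (β / 2 * t) •
        (R (x (max t 0) + Real.exp (-(β / 2) * t) • p)
          - R (x (max t 0) + Real.exp (-(β / 2) * t) • q)) := by
      simp only [H, smul_sub]
      abel
    rw [h1, norm_smul, Real.norm_of_nonneg (Real.exp_pos _).le]
    calc _ ≤ Real.exp (β / 2 * t) * (ε * ‖Real.exp (-(β / 2) * t) • (p - q)‖) := by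
          gcongr
          refine (hRnorm _ _).trans_eq ?_
          rw [add_sub_add_left_eq_sub, smul_sub]
      _ = ε * ‖p - q‖ * (Real.exp (β / 2 * t) * Real.exp (-(β / 2) * t)) := by
          rw [norm_smul, Real.norm_of_nonneg (Real.exp_pos _).le]; ring
      _ = _ := by rw [hexp, mul_one]
  have hHM : ∀ t, ‖H t 0‖ ≤ ε * (4 * CB * δ) := by
    intro t
    have ht := le_max_right t 0
    simp only [H, smul_zero, add_zero, sub_self, zero_sub, norm_neg, norm_smul]
    rw [Real.norm_of_nonneg (Real.exp_pos _).le]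
    calc _ ≤ Real.exp (β / 2 * max t 0) *
          (ε * (4 * CB * δ * Real.exp (-(β / 2) * max t 0))) := by
          gcongr
          exact (hfu _ ht).trans (by gcongr; exact hudecay _ ht)
      _ = ε * (4 * CB * δ) * (Real.exp (β / 2 * max t 0) * Real.exp (-(β / 2) * max t 0)) := by
          ring
      _ = _ := by rw [hexp, mul_one]
  obtain ⟨ψ, hψb, hψ⟩ := exists_bounded_solution_of_exp_decay hCA.le
    (by positivity : 0 < β / 4)
    (fun τ hτ => (norm_exp_smul_add_smul_one_le hA (β / 2) hτ).trans_eq (by ring_nf))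
    hHc hHlip hε.le hHM hεA
  have hψb' : ∀ t, ‖ψ t‖ ≤ 4 * CB * δ := fun t =>
    calc _ ≤ _ := hψb t
      _ = 2 * (CA / (β / 4) * ε) * (4 * CB * δ) := by ring
      _ ≤ 2 * (1 / 2) * (4 * CB * δ) := by gcongr
      _ = _ := by ring
  have hφ : ∀ t, ‖Real.exp (-(β / 2) * t) • ψ t‖ ≤ 4 * CB * δ * Real.exp (-(β / 2) * t) := by
    intro t
    rw [norm_smul, Real.norm_of_nonneg (Real.exp_pos _).le, mul_comm]
    gcongr
    exact hψb' t
  have hzρ : ∀ t, 0 ≤ t → ‖x t + Real.exp (-(β / 2) * t) • ψ t‖ < ρ := by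
    intro t ht
    have h1 : Real.exp (-(β / 2) * t) ≤ 1 := Real.exp_le_one_iff.2 (by nlinarith)
    have h2 : 4 * CB * δ * Real.exp (-(β / 2) * t) ≤ 4 * CB * δ * 1 := by gcongr
    linarith [norm_add_le (x t) (Real.exp (-(β / 2) * t) • ψ t), hφ t, (hxy t ht).1]
  refine ⟨fun t => x t + Real.exp (-(β / 2) * t) • ψ t, fun t ht => ?_,
    12 * CB * δ, by positivity, fun t ht => ?_⟩
  · have hRx := hReq (mem_ball_zero_iff.2 (hxρ t ht))
    have hRz := hReq (mem_ball_zero_iff.2 (hzρ t ht))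
    have he := (((hasDerivAt_id' t).const_mul (-(β / 2))).exp).smul (hψ t)
    refine ((hx t ht).add he).congr_deriv ?_
    simp only [H, max_eq_left ht]
    rw [← hRx, ← hRz]
    simp only [map_add, map_smul, _root_.add_apply, _root_.smul_apply, one_apply_eq_self,
      smul_add, smul_sub, smul_smul, mul_comm (Real.exp (-(β / 2) * t)) (Real.exp (β / 2 * t)),
      hexp, one_smul, mul_one]
    module
  · have h1 := hudecay t ht
    have h2 := hφ t
    have h3 : ‖h (x t) - h (x t + Real.exp (-(β / 2) * t) • ψ t)‖
        ≤ 4 * CB * δ * Real.exp (-(β / 2) * t) := by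
      refine (hhl _ _ ((hxρ t ht).trans_le hρ3) ((hzρ t ht).trans_le hρ3)).trans ?_
      rw [sub_add_cancel_left, norm_neg]
      exact (mul_le_of_le_one_left (norm_nonneg _) hε1).trans h2
    have h4 := norm_sub_le_norm_sub_add_norm_sub (y t) (h (x t))
      (h (x t + Real.exp (-(β / 2) * t) • ψ t))
    simp only [sub_add_cancel_left, norm_neg]
    linarith

theorem Matrix.mem_roots_map_charpoly_iff_mem_spectrum {n : ℕ} (M : Matrix (Fin n) (Fin n) ℝ)
    (μ : ℂ) :
    μ ∈ (M.charpoly.map (algebraMap ℝ ℂ)).roots ↔ μ ∈ spectrum ℂ (M.map (algebraMap ℝ ℂ)) := by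
  rw [Matrix.mem_spectrum_iff_isRoot_charpoly, Matrix.charpoly_map,
    Polynomial.mem_roots ((Matrix.charpoly_monic M).map _).ne_zero]

theorem Multiset.exists_pos_forall_re_lt_neg {S : Multiset ℂ} (hS : ∀ μ ∈ S, μ.re < 0) :
    ∃ β > (0 : ℝ), ∀ μ ∈ S, μ.re < -β := by
  have hev : ∀ᶠ β in 𝓝[>] (0 : ℝ), ∀ μ ∈ (S.toFinset : Set ℂ), μ.re < -β := by
    refine (S.toFinset.finite_toSet.eventually_all).2 fun μ hμ => ?_
    have h0 := hS μ (by simpa using hμ)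
    exact (eventually_lt_nhds (neg_pos.2 h0)).filter_mono nhdsWithin_le_nhds |>.mono
      fun β hβ => by linarith
  obtain ⟨β, hβ, hβ0⟩ := (hev.and self_mem_nhdsWithin).exists
  exact ⟨β, hβ0, fun μ hμ => hβ μ (by simpa using hμ)⟩

theorem Matrix.exists_norm_exp_smul_toLin'_le_of_nonpos {n : ℕ} (M : Matrix (Fin n) (Fin n) ℝ)
    {κ : ℝ} (hM : ∀ μ ∈ spectrum ℂ (M.map (algebraMap ℝ ℂ)), -κ < μ.re) :
    ∃ C : ℝ, 0 < C ∧ ∀ t ≤ 0,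
      ‖NormedSpace.exp (t • (LinearMap.toContinuousLinearMap (Matrix.toLin' M)))‖
        ≤ C * Real.exp (-κ * t) := by
  obtain ⟨C, hC, hexp⟩ := Matrix.exists_norm_exp_smul_toLin'_le (-M) (κ := κ) fun μ hμ => by
    have hneg : (-M).map (algebraMap ℝ ℂ) = -M.map (algebraMap ℝ ℂ) := by ext; simp
    rw [hneg, ← spectrum.neg_eq, Set.mem_neg] at hμ
    have h1 := hM _ hμ
    rw [Complex.neg_re] at h1
    linarith
  refine ⟨C, hC, fun t ht => ?_⟩
  have h1 := hexp (-t) (neg_nonneg.2 ht)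
  rwa [map_neg, map_neg, neg_smul_neg, mul_neg, ← neg_mul] at h1

end CentreManifold

/-- Relevance of the centre manifold: given a centre manifold `y = h x` (over a
ball of radius `δ₀`) for `ẋ = Ax + f(x,y)`, `ẏ = By + g(x,y)`, there are `δ > 0`
and a rate `γ' > 0` such that every solution staying within `δ` of the origin for
all `t ≥ 0` tends exponentially to some solution of the reduced system
`ṡ = As + f(s, h s)`. -/
theorem centre_manifold_relevance
    (m s : ℕ)
    (A : Matrix (Fin m) (Fin m) ℝ) (B : Matrix (Fin s) (Fin s) ℝ)
    (f : (Fin m → ℝ) × (Fin s → ℝ) → (Fin m → ℝ))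
    (g : (Fin m → ℝ) × (Fin s → ℝ) → (Fin s → ℝ))
    (hf : ContDiff ℝ 2 f) (hg : ContDiff ℝ 2 g)
    (hf0 : f 0 = 0) (hg0 : g 0 = 0)
    (hdf0 : fderiv ℝ f 0 = 0) (hdg0 : fderiv ℝ g 0 = 0)
    (hA : ∀ μ ∈ (A.charpoly.map (algebraMap ℝ ℂ)).roots, μ.re = 0)
    (hB : ∀ μ ∈ (B.charpoly.map (algebraMap ℝ ℂ)).roots, μ.re < 0)
    (h : (Fin m → ℝ) → (Fin s → ℝ)) (δ₀ : ℝ) (hδ₀ : 0 < δ₀)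
    (hh1 : ContDiff ℝ 1 h) (hh0 : h 0 = 0) (hdh0 : fderiv ℝ h 0 = 0)
    (hinv : ∀ (I : Set ℝ) (x : ℝ → Fin m → ℝ) (y : ℝ → Fin s → ℝ),
      I.OrdConnected →
      (∀ t ∈ I, HasDerivAt x (A.mulVec (x t) + f (x t, y t)) t) →
      (∀ t ∈ I, HasDerivAt y (B.mulVec (y t) + g (x t, y t)) t) →
      (∀ t ∈ I, ‖x t‖ < δ₀ ∧ ‖y t‖ < δ₀) →
      ∀ t₀ ∈ I, y t₀ = h (x t₀) →
      ∀ t ∈ I, y t = h (x t)) :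
    ∃ δ > (0 : ℝ), ∃ γ' > (0 : ℝ),
      ∀ (x : ℝ → Fin m → ℝ) (y : ℝ → Fin s → ℝ),
        (∀ t : ℝ, 0 ≤ t → HasDerivAt x (A.mulVec (x t) + f (x t, y t)) t) →
        (∀ t : ℝ, 0 ≤ t → HasDerivAt y (B.mulVec (y t) + g (x t, y t)) t) →
        (∀ t : ℝ, 0 ≤ t → ‖x t‖ < δ ∧ ‖y t‖ < δ) →
        ∃ z : ℝ → Fin m → ℝ,
          (∀ t : ℝ, 0 ≤ t →
            HasDerivAt z (A.mulVec (z t) + f (z t, h (z t))) t) ∧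
          ∃ C : ℝ, 0 ≤ C ∧ ∀ t : ℝ, 0 ≤ t →
            ‖x t - z t‖ + ‖y t - h (z t)‖ ≤ C * Real.exp (-γ' * t) := by
  obtain ⟨β, hβ, hβB⟩ := Multiset.exists_pos_forall_re_lt_neg hB
  obtain ⟨CB, hCB, hexpB⟩ := Matrix.exists_norm_exp_smul_toLin'_le B (κ := -β) fun μ hμ =>
    hβB μ ((Matrix.mem_roots_map_charpoly_iff_mem_spectrum B μ).2 hμ)
  obtain ⟨CA, hCA, hexpA⟩ :=
    Matrix.exists_norm_exp_smul_toLin'_le_of_nonpos A (κ := β / 4) fun μ hμ => by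
      rw [hA μ ((Matrix.mem_roots_map_charpoly_iff_mem_spectrum A μ).2 hμ)]
      linarith
  have hf1 : ContDiff ℝ 1 f := hf.of_le one_le_two
  have hg1 : ContDiff ℝ 1 g := hg.of_le one_le_two
  set LA := LinearMap.toContinuousLinearMap (Matrix.toLin' A)
  set LB := LinearMap.toContinuousLinearMap (Matrix.toLin' B)
  obtain ⟨δ, hδ, hmain⟩ := exists_exponentially_asymptotic_reduced_solution hf1 hg1 hh1 hdf0 hdg0
    hh0 hdh0 hβ hCA hCB hexpA hexpB hδ₀ fun x₀ hx₀ hhx₀ =>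
      fderiv_apply_eq_of_locally_invariant
        (X := fun p => LA p.1 + f p) (Y := fun p => LB p.2 + g p)
        ((LA.contDiff.comp contDiff_fst).add hf1) ((LB.contDiff.comp contDiff_snd).add hg1)
        hh1 hinv hx₀ hhx₀
  exact ⟨δ, hδ, β / 2, half_pos hβ, hmain⟩
end

section
/- Approximation of the centre manifold: if φ : ℝ^m → ℝ^s is a C¹ function with φ(0) = 0 and Dφ(0) = 0 whose residual R(s) := Dφ(s)[A s + f(s, φ(s))] − B φ(s) − g(s, φ(s)) satisfies R(s) = O(‖s‖^p) as s → 0 for some p > 1, then the centre manifold satisfies h(s) = φ(s) + O(‖s‖^p) as s → 0, and consequently the reduced vector field satisfies A s + f(s, h(s)) = A s + f(s, φ(s)) + O(‖s‖^p) as s → 0. -/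
open Matrix Polynomial Filter Asymptotics Topology

open scoped Matrix.Norms.L2Operator in
/-- A complex matrix whose eigenvalues lie in the open unit disc has a power of norm at most `1`. -/
theorem exists_pow_l2_opNorm_le_one {n : ℕ} (S : Matrix (Fin n) (Fin n) ℂ)
    (hS : ∀ μ ∈ spectrum ℂ S, ‖μ‖ < 1) : ∃ N : ℕ, 0 < N ∧ ‖S ^ N‖ ≤ 1 := by
  rcases subsingleton_or_nontrivial (Matrix (Fin n) (Fin n) ℂ) with hn | hn
  · exact ⟨1, one_pos, by rw [Subsingleton.elim (S ^ 1) 0]; simp⟩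
  have hr : spectralRadius ℂ S < (1 : NNReal) :=
    spectrum.spectralRadius_lt_of_forall_lt S fun μ hμ => by
      simpa [← NNReal.coe_lt_coe] using hS μ hμ
  have hev := (spectrum.pow_nnnorm_pow_one_div_tendsto_nhds_spectralRadius S).eventually
    (gt_mem_nhds hr)
  obtain ⟨N, hN, hN0⟩ := (hev.and (eventually_gt_atTop 0)).exists
  refine ⟨N, hN0, ?_⟩
  have hN' : (0 : ℝ) < 1 / N := by positivity
  by_contra! hlt
  refine hN.not_ge ?_
  rw [ENNReal.coe_one]
  exact ENNReal.one_le_rpow (by exact_mod_cast hlt.le) hN'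

open scoped Matrix.Norms.L2Operator in
/-- A real matrix whose complex eigenvalues lie in the open unit disc has a power that does not
increase Euclidean lengths. -/
theorem exists_pow_mulVec_dotProduct_le {n : ℕ} (S : Matrix (Fin n) (Fin n) ℝ)
    (hS : ∀ μ ∈ spectrum ℂ (S.map (algebraMap ℝ ℂ)), ‖μ‖ < 1) :
    ∃ N : ℕ, 0 < N ∧ ∀ x, (S ^ N *ᵥ x) ⬝ᵥ (S ^ N *ᵥ x) ≤ x ⬝ᵥ x := by
  obtain ⟨N, hN, hle⟩ := exists_pow_l2_opNorm_le_one _ hS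
  refine ⟨N, hN, fun x => ?_⟩
  have hnorm : ∀ v : Fin n → ℝ,
      ‖WithLp.toLp 2 (fun i => algebraMap ℝ ℂ (v i))‖ ^ 2 = v ⬝ᵥ v := fun v => by
    rw [EuclideanSpace.norm_sq_eq]
    simp [dotProduct, sq]
  have hmul : (S.map (algebraMap ℝ ℂ)) ^ N *ᵥ (fun i => algebraMap ℝ ℂ (x i)) =
      fun i => algebraMap ℝ ℂ ((S ^ N *ᵥ x) i) := by
    rw [← Matrix.map_pow]
    ext i
    simp [mulVec, dotProduct]
  have := Matrix.l2_opNorm_mulVec ((S.map (algebraMap ℝ ℂ)) ^ N)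
    (WithLp.toLp 2 (fun i => algebraMap ℝ ℂ (x i)))
  simp only [hmul] at this
  rw [← hnorm, ← hnorm]
  gcongr
  exact this.trans (mul_le_of_le_one_left (norm_nonneg _) hle)

/-- A real matrix whose complex eigenvalues have negative real part is dissipative for some
symmetric bilinear form dominating the Euclidean one. -/
theorem exists_lyapunov_form {n : ℕ} (M : Matrix (Fin n) (Fin n) ℝ)
    (hM : ∀ μ ∈ spectrum ℂ (M.map (algebraMap ℝ ℂ)), μ.re < 0) :
    ∃ b : (Fin n → ℝ) →L[ℝ] (Fin n → ℝ) →L[ℝ] ℝ,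
      (∀ x y, b x y = b y x) ∧ (∀ x, x ⬝ᵥ x ≤ b x x) ∧ ∀ x, b x (M *ᵥ x) ≤ 0 := by
  set MC := M.map (algebraMap ℝ ℂ) with hMC
  obtain ⟨τ, hτ, hτ0⟩ : ∃ τ : ℝ, (∀ μ ∈ spectrum ℂ MC, ‖1 + τ * μ‖ < 1) ∧ 0 < τ := by
    have hfin : (spectrum ℂ MC).Finite := Matrix.finite_spectrum MC
    have : ∀ᶠ τ : ℝ in 𝓝[>] 0, ∀ μ ∈ spectrum ℂ MC, ‖1 + τ * μ‖ < 1 := by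
      rw [eventually_all_finite hfin]
      intro μ hμ
      have hlim : Tendsto (fun τ : ℝ => 2 * μ.re + τ * Complex.normSq μ) (𝓝[>] 0)
          (𝓝 (2 * μ.re + 0 * Complex.normSq μ)) :=
        ((by fun_prop : Continuous fun τ : ℝ => 2 * μ.re + τ * Complex.normSq μ).tendsto 0).mono_left
          nhdsWithin_le_nhds
      have hneg : 2 * μ.re + 0 * Complex.normSq μ < 0 := by linarith [hM μ hμ]
      filter_upwards [hlim.eventually (gt_mem_nhds hneg), self_mem_nhdsWithin] with τ h1 h2
      have h2 : 0 < τ := h2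
      rw [← sq_lt_one_iff₀ (norm_nonneg _), Complex.sq_norm, Complex.normSq_apply]
      rw [Complex.normSq_apply] at h1
      simp
      nlinarith
    exact (this.and self_mem_nhdsWithin).exists
  set S := 1 + τ • M with hS
  obtain ⟨N, hN, hcontr⟩ := exists_pow_mulVec_dotProduct_le S (by
    intro μ hμ
    have hmap : S.map (algebraMap ℝ ℂ) = algebraMap ℂ _ 1 + (τ : ℂ) • MC := by
      ext i j
      by_cases hij : i = j <;> simp [hS, hMC, hij]
    rw [hmap, ← spectrum.singleton_add_eq, Set.singleton_add] at hμ
    obtain ⟨ν, hν, rfl⟩ := hμ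
    have hτC : (τ : ℂ) ≠ 0 := by exact_mod_cast hτ0.ne'
    have hu := spectrum.unit_smul_eq_smul MC (Units.mk0 (τ : ℂ) hτC)
    rw [show (τ : ℂ) • MC = Units.mk0 (τ : ℂ) hτC • MC from rfl, hu] at hν
    obtain ⟨κ, hκ, rfl⟩ := hν
    exact hτ κ hκ)
  let b₀ : (Fin n → ℝ) →ₗ[ℝ] (Fin n → ℝ) →ₗ[ℝ] ℝ :=
    LinearMap.mk₂ ℝ (fun x y => ∑ k ∈ Finset.range N, (S ^ k *ᵥ x) ⬝ᵥ (S ^ k *ᵥ y))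
      (by intros; simp [mulVec_add, Finset.sum_add_distrib])
      (by intros; simp [mulVec_smul, Finset.mul_sum])
      (by intros; simp [mulVec_add, Finset.sum_add_distrib])
      (by intros; simp [mulVec_smul, Finset.mul_sum])
  have hb : ∀ x y, b₀.toContinuousBilinearMap x y =
      ∑ k ∈ Finset.range N, (S ^ k *ᵥ x) ⬝ᵥ (S ^ k *ᵥ y) := fun x y => rfl
  have hself : ∀ v : Fin n → ℝ, 0 ≤ v ⬝ᵥ v := fun v =>
    Finset.sum_nonneg fun i _ => mul_self_nonneg _
  have hsymm : ∀ x y, b₀.toContinuousBilinearMap x y = b₀.toContinuousBilinearMap y x :=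
    fun x y => by simp only [hb, dotProduct_comm]
  refine ⟨b₀.toContinuousBilinearMap, hsymm, fun x => ?_, fun x => ?_⟩
  · rw [hb]
    simpa using Finset.single_le_sum (f := fun k => (S ^ k *ᵥ x) ⬝ᵥ (S ^ k *ᵥ x))
      (fun k _ => hself _) (Finset.mem_range.2 hN)
  · set b := b₀.toContinuousBilinearMap
    have hstep : b (S *ᵥ x) (S *ᵥ x) ≤ b x x := by
      have h1 := Finset.sum_range_succ (fun k => (S ^ k *ᵥ x) ⬝ᵥ (S ^ k *ᵥ x)) N
      have h2 := Finset.sum_range_succ' (fun k => (S ^ k *ᵥ x) ⬝ᵥ (S ^ k *ᵥ x)) N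
      have h3 := hcontr x
      simp only [hb, mulVec_mulVec, ← pow_succ]
      simp only [pow_zero, one_mulVec] at h2
      linarith
    have hexp : S *ᵥ x = x + τ • (M *ᵥ x) := by
      rw [hS, add_mulVec, one_mulVec, smul_mulVec]
    have hpos : 0 ≤ b (M *ᵥ x) (M *ᵥ x) := by
      rw [hb]
      exact Finset.sum_nonneg fun k _ => hself _
    rw [hexp] at hstep
    simp only [map_add, map_smul, _root_.add_apply, _root_.smul_apply,
      smul_eq_mul] at hstep
    rw [hsymm (M *ᵥ x) x] at hstep
    by_contra! hpos'
    have := mul_pos hτ0 hpos'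
    have := mul_nonneg hτ0.le (mul_nonneg hτ0.le hpos)
    linarith

/-- If all complex eigenvalues of a real matrix `M` have real part less than `c`, then `M` has
numerical range bounded by `c` for some inner product dominating the square of the sup norm. -/
theorem exists_adapted_form {n : ℕ} (M : Matrix (Fin n) (Fin n) ℝ) (c : ℝ)
    (hM : ∀ μ ∈ spectrum ℂ (M.map (algebraMap ℝ ℂ)), μ.re < c) :
    ∃ b : (Fin n → ℝ) →L[ℝ] (Fin n → ℝ) →L[ℝ] ℝ,
      (∀ x y, b x y = b y x) ∧ (∀ x, ‖x‖ ^ 2 ≤ b x x) ∧ ∀ x, b x (M *ᵥ x) ≤ c * b x x := by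
  obtain ⟨b, hsymm, hpos, hneg⟩ := exists_lyapunov_form (M - c • 1) (by
    intro μ hμ
    have hmap : (M - c • (1 : Matrix (Fin n) (Fin n) ℝ)).map (algebraMap ℝ ℂ) =
        M.map (algebraMap ℝ ℂ) - algebraMap ℂ _ (c : ℂ) := by
      ext i j
      by_cases hij : i = j <;> simp [hij, Matrix.algebraMap_matrix_apply]
    rw [hmap, ← spectrum.sub_singleton_eq, Set.sub_singleton] at hμ
    obtain ⟨ν, hν, rfl⟩ := hμ
    simpa using hM ν hν)
  refine ⟨b, hsymm, fun x => (?_ : _ ≤ x ⬝ᵥ x).trans (hpos x), fun x => ?_⟩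
  · have hnn : 0 ≤ x ⬝ᵥ x := Finset.sum_nonneg fun i _ => mul_self_nonneg _
    rw [← Real.le_sqrt (norm_nonneg _) hnn, pi_norm_le_iff_of_nonneg (Real.sqrt_nonneg _)]
    intro i
    rw [Real.le_sqrt (norm_nonneg _) hnn, Real.norm_eq_abs, sq_abs, sq]
    exact Finset.single_le_sum (f := fun i => x i * x i) (fun i _ => mul_self_nonneg _)
      (Finset.mem_univ i)
  · have := hneg x
    rw [sub_mulVec, smul_mulVec, one_mulVec, map_sub, map_smul, smul_eq_mul] at this
    linarith

/-- Complex eigenvalues of a real matrix are complex roots of its characteristic polynomial. -/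
theorem mem_roots_charpoly_of_mem_spectrum {n : ℕ} {M : Matrix (Fin n) (Fin n) ℝ} {μ : ℂ}
    (hμ : μ ∈ spectrum ℂ (M.map (algebraMap ℝ ℂ))) :
    μ ∈ (M.charpoly.map (algebraMap ℝ ℂ)).roots := by
  rw [Matrix.mem_spectrum_iff_isRoot_charpoly, Matrix.charpoly_map] at hμ
  exact (mem_roots ((Matrix.charpoly_monic M).map _).ne_zero).2 hμ

/-- If the graph of `h` is locally invariant under a `C¹` vector field, then `h` satisfies the
invariance equation near the origin. -/
theorem eventually_invariance_equation {E F : Type*} [NormedAddCommGroup E] [NormedSpace ℝ E]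
    [CompleteSpace E] [NormedAddCommGroup F] [NormedSpace ℝ F] [CompleteSpace F]
    {X : E × F → E} {Y : E × F → F} (hX : ContDiff ℝ 1 X) (hY : ContDiff ℝ 1 Y)
    {h : E → F} {δ : ℝ} (hδ : 0 < δ) (hh : ContDiff ℝ 1 h) (hh0 : h 0 = 0)
    (hinv : ∀ (I : Set ℝ) (x : ℝ → E) (y : ℝ → F), I.OrdConnected →
      (∀ t ∈ I, HasDerivAt x (X (x t, y t)) t) → (∀ t ∈ I, HasDerivAt y (Y (x t, y t)) t) →
      (∀ t ∈ I, ‖x t‖ < δ ∧ ‖y t‖ < δ) → ∀ t₀ ∈ I, y t₀ = h (x t₀) → ∀ t ∈ I, y t = h (x t)) :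
    ∀ᶠ z in 𝓝 (0 : E), fderiv ℝ h z (X (z, h z)) = Y (z, h z) := by
  have hz1 : ∀ᶠ z in 𝓝 (0 : E), ‖z‖ < δ :=
    continuous_norm.continuousAt.eventually_lt continuousAt_const (by simpa)
  have hz2 : ∀ᶠ z in 𝓝 (0 : E), ‖h z‖ < δ :=
    hh.continuous.norm.continuousAt.eventually_lt continuousAt_const (by simpa [hh0])
  filter_upwards [hz1, hz2] with z h1 h2
  obtain ⟨α, hα0, ε, hε, hα⟩ :=
    ContDiffAt.exists_forall_mem_closedBall_exists_eq_forall_mem_Ioo_hasDerivAt₀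
      (f := fun u : E × F => (X u, Y u)) (x₀ := (z, h z)) (hX.prodMk hY).contDiffAt 0
  have hα00 : HasDerivAt α (X (α 0), Y (α 0)) 0 := hα 0 (by simpa using hε)
  have hc1 : ∀ᶠ t in 𝓝 (0 : ℝ), ‖(α t).1‖ < δ :=
    hα00.continuousAt.fst.norm.eventually_lt continuousAt_const (by simpa [hα0])
  have hc2 : ∀ᶠ t in 𝓝 (0 : ℝ), ‖(α t).2‖ < δ :=
    hα00.continuousAt.snd.norm.eventually_lt continuousAt_const (by simpa [hα0])
  have hc3 : ∀ᶠ t in 𝓝 (0 : ℝ), t ∈ Set.Ioo (0 - ε) (0 + ε) :=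
    Ioo_mem_nhds (by linarith) (by linarith)
  obtain ⟨η, hη, hball⟩ := Metric.eventually_nhds_iff_ball.1 (hc1.and (hc2.and hc3))
  have hgraph := hinv (Metric.ball 0 η) (fun t => (α t).1) (fun t => (α t).2)
    (by rw [Real.ball_eq_Ioo]; exact Set.ordConnected_Ioo)
    (fun t ht => (hα t (hball t ht).2.2).fst) (fun t ht => (hα t (hball t ht).2.2).snd)
    (fun t ht => ⟨(hball t ht).1, (hball t ht).2.1⟩) 0 (Metric.mem_ball_self hη) (by simp [hα0])
  have hy1 : HasDerivAt (fun t => (α t).2) (Y (z, h z)) 0 := by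
    rw [hα0] at hα00; exact hα00.snd
  have hx : HasDerivAt (fun t => (α t).1) (X (z, h z)) 0 := by
    rw [hα0] at hα00; exact hα00.fst
  have hh' : HasFDerivAt h (fderiv ℝ h z) (α 0).1 := by
    rw [hα0]; exact (hh.differentiable one_ne_zero z).hasFDerivAt
  have hy2 : HasDerivAt (fun t => (α t).2) (fderiv ℝ h z (X (z, h z))) 0 :=
    (hh'.comp_hasDerivAt 0 hx).congr_of_eventuallyEq
      (by filter_upwards [Metric.ball_mem_nhds _ hη] with t ht using hgraph t ht)
  exact hy2.unique hy1

/-- A comparison principle: a solution of a perturbed linear transport equation that contracts at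
rate `β`, along a vector field pointing inwards at rate at most `β / (4 p)`, is dominated by its
source term `‖z‖ ^ p`. -/
theorem isBigO_rpow_of_transport {E F : Type*} [NormedAddCommGroup E] [NormedSpace ℝ E]
    [ProperSpace E] [NormedAddCommGroup F] [NormedSpace ℝ F]
    (a : E →L[ℝ] E →L[ℝ] ℝ) (hasymm : ∀ x y, a x y = a y x) (hapos : ∀ x, ‖x‖ ^ 2 ≤ a x x)
    (b : F →L[ℝ] F →L[ℝ] ℝ) (hbsymm : ∀ x y, b x y = b y x) (hbpos : ∀ x, ‖x‖ ^ 2 ≤ b x x)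
    {B : F → F} {β p : ℝ} (hβ : 0 < β) (hp : 1 ≤ p) (hB : ∀ y, b y (B y) ≤ -β * b y y)
    {V : E → E} (hV : ∀ᶠ z in 𝓝 (0 : E), -(β / (4 * p)) * a z z ≤ a z (V z))
    {w : E → F} (hw : Differentiable ℝ w) (hw0 : w 0 = 0) {ε C : ℝ}
    (hε : ‖b‖ * ε ≤ β / 4)
    (hwV : ∀ᶠ z in 𝓝 (0 : E), ‖fderiv ℝ w z (V z) - B (w z)‖ ≤ ε * ‖w z‖ + C * ‖z‖ ^ p) :
    w =O[𝓝 0] fun z => ‖z‖ ^ p := by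
  have hp0 : 0 < p := by linarith
  have ha0 : ∀ x, 0 ≤ a x x := fun x => (sq_nonneg _).trans (hapos x)
  obtain ⟨δ, hδ, hball⟩ := Metric.nhds_basis_closedBall.eventually_iff.1 (hV.and hwV)
  have hwc : Continuous w := hw.continuous
  have hbc : Continuous fun z => b (w z) (w z) := by fun_prop
  have hac : Continuous fun z => (a z z) ^ p :=
    (by fun_prop : Continuous fun z => a z z).rpow_const fun _ => Or.inr hp0.le
  obtain ⟨M, hM⟩ := (isCompact_closedBall (0 : E) δ).bddAbove_image hbc.continuousOn
  have hδp : 0 < (δ ^ 2) ^ p := by positivity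
  obtain ⟨K, hK1, hKM, hKC⟩ : ∃ K : ℝ, 1 ≤ K ∧ M / (δ ^ 2) ^ p ≤ K ∧ 4 * (‖b‖ * C) / β ≤ K :=
    ((eventually_ge_atTop _).and ((eventually_ge_atTop _).and (eventually_ge_atTop _))).exists
  have hK0 : 0 < K := by linarith
  rw [div_le_iff₀ hδp] at hKM
  rw [div_le_iff₀ hβ] at hKC
  have hle : ∀ z ∈ Metric.closedBall (0 : E) δ, b (w z) (w z) ≤ K ^ 2 * (a z z) ^ p := by
    have hGc : Continuous fun z => b (w z) (w z) - K ^ 2 * (a z z) ^ p :=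
      hbc.sub (hac.const_mul (K ^ 2))
    obtain ⟨z, hz, hmax⟩ := (isCompact_closedBall (0 : E) δ).exists_isMaxOn
      ⟨0, Metric.mem_closedBall_self hδ.le⟩
      hGc.continuousOn
    suffices hz0 : b (w z) (w z) - K ^ 2 * (a z z) ^ p ≤ 0 from fun x hx => by
      have : b (w x) (w x) - K ^ 2 * (a x x) ^ p ≤ _ := hmax hx
      linarith
    by_contra! hpos
    have hnorm : ‖z‖ ≤ δ := by simpa using hz
    rcases hnorm.eq_or_lt with hzδ | hzδ
    · have h1 : b (w z) (w z) ≤ M := hM ⟨z, hz, rfl⟩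
      have h2 : (δ ^ 2) ^ p ≤ (a z z) ^ p := by
        gcongr
        rw [← hzδ]
        exact hapos z
      have h3 : K ≤ K ^ 2 := by nlinarith
      have h4 : K * (δ ^ 2) ^ p ≤ K ^ 2 * (a z z) ^ p := by gcongr
      linarith
    · have hlocal : IsLocalMax (fun z => b (w z) (w z) - K ^ 2 * (a z z) ^ p) z :=
        hmax.isLocalMax (mem_of_superset (Metric.isOpen_ball.mem_nhds (by simpa using hzδ))
          Metric.ball_subset_closedBall)
      have hdw := (hw z).hasFDerivAt
      have hdb := b.hasFDerivAt_of_bilinear hdw hdw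
      have hda := (a.hasFDerivAt_of_bilinear (hasFDerivAt_id z) (hasFDerivAt_id z)).rpow_const
        (p := p) (Or.inr hp)
      have hzero := hlocal.hasFDerivAt_eq_zero (hdb.sub (hda.const_mul (K ^ 2)))
      have hzeroV := DFunLike.congr_fun hzero (V z)
      simp only [ContinuousLinearMap.precompR_apply, ContinuousLinearMap.precompL_apply,
        ContinuousLinearMap.compL_apply, ContinuousLinearMap.comp_apply,
        _root_.sub_apply, _root_.add_apply, _root_.smul_apply, smul_eq_mul, id_eq,
        ContinuousLinearMap.coe_id', _root_.zero_apply] at hzeroV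
      rw [hbsymm (fderiv ℝ w z (V z)), hasymm (V z) z] at hzeroV
      obtain ⟨h1, h2⟩ := hball hz
      set Q := b (w z) (w z) with hQ
      set q := a z z with hq
      have hq0 : 0 ≤ q := ha0 z
      have hqp : 0 ≤ q ^ p := Real.rpow_nonneg hq0 p
      have hQpos : 0 < Q := lt_of_le_of_lt (by positivity) (sub_pos.1 hpos)
      have hsplit : b (w z) (fderiv ℝ w z (V z)) =
          b (w z) (B (w z)) + b (w z) (fderiv ℝ w z (V z) - B (w z)) := by
        rw [← map_add, add_sub_cancel]
      have herr : b (w z) (fderiv ℝ w z (V z) - B (w z)) ≤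
          ‖b‖ * ‖w z‖ * (ε * ‖w z‖ + C * ‖z‖ ^ p) := by
        refine (le_abs_self _).trans ((b.le_opNorm₂ _ _).trans ?_)
        gcongr
      have hzp : (‖z‖ ^ p) ^ 2 ≤ q ^ p := by
        rw [← Real.rpow_natCast, ← Real.rpow_mul (norm_nonneg _), mul_comm p,
          Real.rpow_mul (norm_nonneg _), Real.rpow_natCast]
        gcongr
        exact hapos z
      have hzp0 : 0 ≤ ‖z‖ ^ p := by positivity
      have hcross : K * (‖w z‖ * ‖z‖ ^ p) ≤ Q := by
        have := hbpos (w z)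
        nlinarith [sq_nonneg (‖w z‖ - K * ‖z‖ ^ p), mul_le_mul_of_nonneg_left hzp (sq_nonneg K)]
      have hC1 : 4 * (‖b‖ * C * (‖w z‖ * ‖z‖ ^ p)) ≤ β * Q := by
        have h3 := mul_le_mul_of_nonneg_right hKC (by positivity : 0 ≤ ‖w z‖ * ‖z‖ ^ p)
        have h4 := mul_le_mul_of_nonneg_left hcross hβ.le
        linarith
      have hε1 : ‖b‖ * ε * ‖w z‖ ^ 2 ≤ β / 4 * Q :=
        (mul_le_mul_of_nonneg_right hε (sq_nonneg _)).trans
          (mul_le_mul_of_nonneg_left (hbpos _) (by positivity))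
      have hqV : -(β / 4) * q ^ p ≤ p * q ^ (p - 1) * a z (V z) := by
        rcases hq0.eq_or_lt with h0 | h0
        · have hz0 : z = 0 := by
            have := hapos z
            rw [← norm_eq_zero]
            exact pow_eq_zero_iff two_ne_zero |>.1 (le_antisymm (this.trans h0.symm.le) (sq_nonneg _))
          simp [hQ, hz0, hw0] at hQpos
        · have h3 : q ^ p = q ^ (p - 1) * q := by
            rw [Real.rpow_sub_one h0.ne', div_mul_cancel₀ _ h0.ne']
          have h4 := mul_le_mul_of_nonneg_left h1
            (by positivity : 0 ≤ p * q ^ (p - 1))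
          refine le_trans (le_of_eq ?_) h4
          rw [h3]
          field_simp
      have hBz := hB (w z)
      have hfin := mul_le_mul_of_nonneg_left hqV (sq_nonneg K)
      have hQq : β / 4 * (K ^ 2 * q ^ p) ≤ β / 4 * Q := by
        have := sub_pos.1 hpos
        gcongr
      have := mul_pos hβ hQpos
      nlinarith
  refine IsBigO.of_bound (K * √(‖a‖ ^ p)) ?_
  filter_upwards [Metric.closedBall_mem_nhds (0 : E) hδ] with z hz
  have hzp0 : 0 ≤ ‖z‖ ^ p := by positivity
  rw [Real.norm_of_nonneg hzp0]
  refine le_of_sq_le_sq ?_ (by positivity)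
  calc ‖w z‖ ^ 2 ≤ b (w z) (w z) := hbpos _
    _ ≤ K ^ 2 * (a z z) ^ p := hle z hz
    _ ≤ K ^ 2 * (‖a‖ * ‖z‖ ^ 2) ^ p := by
      gcongr
      · exact ha0 z
      · rw [sq, ← mul_assoc]
        exact (le_abs_self _).trans (a.le_opNorm₂ z z)
    _ = (K * √(‖a‖ ^ p) * ‖z‖ ^ p) ^ 2 := by
      rw [Real.mul_rpow (norm_nonneg a) (by positivity), mul_pow, mul_pow,
        Real.sq_sqrt (by positivity), ← Real.rpow_natCast (‖z‖ ^ p), ← Real.rpow_mul (norm_nonneg z),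
        mul_comm p, Real.rpow_mul (norm_nonneg z), Real.rpow_natCast]
      ring

/-- A `C²` map with vanishing derivative at a point is Lipschitz near it with any positive
constant. -/
theorem eventually_norm_sub_le {E F : Type*} [NormedAddCommGroup E] [NormedSpace ℝ E]
    [NormedAddCommGroup F] [NormedSpace ℝ F] {f : E → F} (hf : ContDiff ℝ 2 f) {x : E}
    (hdf : fderiv ℝ f x = 0) {c : ℝ} (hc : 0 < c) :
    ∀ᶠ u : E × E in 𝓝 (x, x), ‖f u.1 - f u.2‖ ≤ c * ‖u.1 - u.2‖ := by
  have hs := (hf.contDiffAt (x := x)).hasStrictFDerivAt two_ne_zero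
  rw [hdf] at hs
  simpa using hs.isLittleO.bound hc

/-- Approximation of the centre manifold: if `φ` is `C¹` with `φ 0 = 0`,
`Dφ 0 = 0`, and the residual
`R z = Dφ(z)[Az + f(z, φ z)] − Bφ(z) − g(z, φ z)` is `O(‖z‖^p)` as `z → 0` for
some `p > 1`, then the centre manifold `h` satisfies `h z = φ z + O(‖z‖^p)`, and
the reduced vector field satisfies
`Az + f(z, h z) = Az + f(z, φ z) + O(‖z‖^p)` as `z → 0`. -/
theorem centre_manifold_approximation
    (m s : ℕ)
    (A : Matrix (Fin m) (Fin m) ℝ) (B : Matrix (Fin s) (Fin s) ℝ)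
    (f : (Fin m → ℝ) × (Fin s → ℝ) → (Fin m → ℝ))
    (g : (Fin m → ℝ) × (Fin s → ℝ) → (Fin s → ℝ))
    (hf : ContDiff ℝ 2 f) (hg : ContDiff ℝ 2 g)
    (hf0 : f 0 = 0) (hg0 : g 0 = 0)
    (hdf0 : fderiv ℝ f 0 = 0) (hdg0 : fderiv ℝ g 0 = 0)
    (hA : ∀ μ ∈ (A.charpoly.map (algebraMap ℝ ℂ)).roots, μ.re = 0)
    (hB : ∀ μ ∈ (B.charpoly.map (algebraMap ℝ ℂ)).roots, μ.re < 0)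
    (h : (Fin m → ℝ) → (Fin s → ℝ)) (δ₀ : ℝ) (hδ₀ : 0 < δ₀)
    (hh1 : ContDiff ℝ 1 h) (hh0 : h 0 = 0) (hdh0 : fderiv ℝ h 0 = 0)
    (hinv : ∀ (I : Set ℝ) (x : ℝ → Fin m → ℝ) (y : ℝ → Fin s → ℝ),
      I.OrdConnected →
      (∀ t ∈ I, HasDerivAt x (A.mulVec (x t) + f (x t, y t)) t) →
      (∀ t ∈ I, HasDerivAt y (B.mulVec (y t) + g (x t, y t)) t) →
      (∀ t ∈ I, ‖x t‖ < δ₀ ∧ ‖y t‖ < δ₀) →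
      ∀ t₀ ∈ I, y t₀ = h (x t₀) →
      ∀ t ∈ I, y t = h (x t))
    (φ : (Fin m → ℝ) → (Fin s → ℝ))
    (hφ1 : ContDiff ℝ 1 φ) (hφ0 : φ 0 = 0) (hdφ0 : fderiv ℝ φ 0 = 0)
    (p : ℝ) (hp : 1 < p)
    (hres : (fun z : Fin m → ℝ =>
        fderiv ℝ φ z (A.mulVec z + f (z, φ z)) - B.mulVec (φ z) - g (z, φ z))
        =O[𝓝 0] fun z : Fin m → ℝ => ‖z‖ ^ p) :
    ((fun z : Fin m → ℝ => h z - φ z) =O[𝓝 0] fun z : Fin m → ℝ => ‖z‖ ^ p) ∧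
    ((fun z : Fin m → ℝ =>
        (A.mulVec z + f (z, h z)) - (A.mulVec z + f (z, φ z)))
        =O[𝓝 0] fun z : Fin m → ℝ => ‖z‖ ^ p) := by
  have hp0 : 0 < p := by linarith
  obtain ⟨β, hBβ, hβ⟩ : ∃ β : ℝ,
      (∀ μ ∈ (B.charpoly.map (algebraMap ℝ ℂ)).roots, μ.re < -β) ∧ 0 < β := by
    have : ∀ᶠ β : ℝ in 𝓝[>] 0,
        ∀ μ ∈ (B.charpoly.map (algebraMap ℝ ℂ)).roots.toFinset, μ.re < -β := by
      rw [eventually_all_finset]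
      intro μ hμ
      have hneg := hB μ (Multiset.mem_toFinset.1 hμ)
      filter_upwards [nhdsWithin_le_nhds (gt_mem_nhds (neg_pos.2 hneg))] with β hβ
      linarith
    obtain ⟨β, h1, h2⟩ := (this.and self_mem_nhdsWithin).exists
    exact ⟨β, fun μ hμ => h1 μ (Multiset.mem_toFinset.2 hμ), h2⟩
  obtain ⟨b, hbsymm, hbpos, hbB⟩ := exists_adapted_form B (-β) fun μ hμ =>
    hBβ μ (mem_roots_charpoly_of_mem_spectrum hμ)
  have hκ : 0 < β / (8 * p) := by positivity
  obtain ⟨a, hasymm, hapos, haA⟩ := exists_adapted_form (-A) (β / (8 * p)) fun μ hμ => by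
    have hμ' : -μ ∈ spectrum ℂ (A.map (algebraMap ℝ ℂ)) := by
      have hmap : (-A).map (algebraMap ℝ ℂ) = -A.map (algebraMap ℝ ℂ) := by
        ext i j
        simp
      rwa [← Set.mem_neg, spectrum.neg_eq, ← hmap]
    have := hA _ (mem_roots_charpoly_of_mem_spectrum hμ')
    rw [Complex.neg_re] at this
    linarith
  have htend : Tendsto (fun z => ((z, h z), (z, φ z))) (𝓝 0) (𝓝 (0, 0)) := by
    have hc := hh1.continuous
    have hc' := hφ1.continuous
    exact (by fun_prop : Continuous fun z => ((z, h z), (z, φ z))).tendsto' _ _ (by simp [hh0, hφ0])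
  have hdiff : ∀ z, (z, h z) - (z, φ z) = ((0 : Fin m → ℝ), h z - φ z) := fun z => by simp
  have hfw : ∀ c > 0, ∀ᶠ z in 𝓝 (0 : Fin m → ℝ), ‖f (z, h z) - f (z, φ z)‖ ≤ c * ‖h z - φ z‖ :=
    fun c hc => by
      filter_upwards [htend.eventually (eventually_norm_sub_le hf hdf0 hc)] with z hz
      simpa [hdiff, Prod.norm_def] using hz
  have hgw : ∀ c > 0, ∀ᶠ z in 𝓝 (0 : Fin m → ℝ), ‖g (z, h z) - g (z, φ z)‖ ≤ c * ‖h z - φ z‖ :=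
    fun c hc => by
      filter_upwards [htend.eventually (eventually_norm_sub_le hg hdg0 hc)] with z hz
      simpa [hdiff, Prod.norm_def] using hz
  have hmain : (fun z : Fin m → ℝ => h z - φ z) =O[𝓝 0] fun z : Fin m → ℝ => ‖z‖ ^ p := by
    obtain ⟨C, hres⟩ := hres.bound
    have hε : 0 < β / (4 * (‖b‖ + 1)) := by positivity
    have hVf : ∀ᶠ z in 𝓝 (0 : Fin m → ℝ), ‖f (z, h z)‖ ≤ β / (8 * p) / (‖a‖ + 1) * ‖z‖ := by
      have hc := hh1.continuous
      have ht : Tendsto (fun z : Fin m → ℝ => ((z, h z), (0 : (Fin m → ℝ) × (Fin s → ℝ)))) (𝓝 0)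
          (𝓝 (0, 0)) :=
        (by fun_prop : Continuous fun z : Fin m → ℝ =>
          ((z, h z), (0 : (Fin m → ℝ) × (Fin s → ℝ)))).tendsto' _ _ (by simp [hh0])
      have hd := (hh1.differentiable one_ne_zero 0).hasFDerivAt
      rw [hdh0] at hd
      have hhz : ∀ᶠ z in 𝓝 (0 : Fin m → ℝ), ‖h z‖ ≤ 1 * ‖z‖ := by
        simpa [hh0] using hd.isLittleO.bound one_pos
      filter_upwards [ht.eventually (eventually_norm_sub_le hf hdf0
        (by positivity : 0 < β / (8 * p) / (‖a‖ + 1))), hhz] with z h1 h2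
      simpa [hf0, Prod.norm_def, max_eq_left (h2.trans_eq (one_mul _))] using h1
    refine isBigO_rpow_of_transport a hasymm hapos b hbsymm hbpos (B := fun y => B *ᵥ y) hβ hp.le
      hbB (V := fun z => A *ᵥ z + f (z, h z)) ?_
      ((hh1.differentiable one_ne_zero).sub (hφ1.differentiable one_ne_zero))
      (by simp [hh0, hφ0]) (ε := β / (4 * (‖b‖ + 1))) (C := C) ?_ ?_
    · filter_upwards [hVf] with z hz
      have h1 := haA z
      rw [neg_mulVec, map_neg] at h1
      have h2 : -(‖a‖ * ‖z‖ * ‖f (z, h z)‖) ≤ a z (f (z, h z)) :=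
        neg_le_of_abs_le (a.le_opNorm₂ z _)
      have h3 : ‖a‖ * ‖z‖ * ‖f (z, h z)‖ ≤ β / (8 * p) * ‖z‖ ^ 2 := by
        calc ‖a‖ * ‖z‖ * ‖f (z, h z)‖ ≤ (‖a‖ + 1) * ‖z‖ * (β / (8 * p) / (‖a‖ + 1) * ‖z‖) := by
              gcongr
              linarith
          _ = β / (8 * p) * ‖z‖ ^ 2 := by
              field_simp
      have h4 := mul_le_mul_of_nonneg_left (hapos z) hκ.le
      have h5 : β / (4 * p) = β / (8 * p) + β / (8 * p) := by
        field_simp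
        norm_num
      rw [map_add, h5]
      linarith
    · rw [mul_div_assoc', div_le_div_iff₀ (by positivity) (by norm_num)]
      nlinarith [norm_nonneg b]
    · have hdφ : ∀ᶠ z in 𝓝 (0 : Fin m → ℝ), ‖fderiv ℝ φ z‖ < 1 :=
        (hφ1.continuous_fderiv one_ne_zero).norm.continuousAt.eventually_lt continuousAt_const
          (by simp [hdφ0])
      have hFf : ContDiff ℝ 1 fun u : (Fin m → ℝ) × (Fin s → ℝ) => A *ᵥ u.1 + f u :=
        ((Matrix.mulVecLin A).toContinuousLinearMap.contDiff.comp contDiff_fst).add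
          (hf.of_le one_le_two)
      have hFg : ContDiff ℝ 1 fun u : (Fin m → ℝ) × (Fin s → ℝ) => B *ᵥ u.2 + g u :=
        ((Matrix.mulVecLin B).toContinuousLinearMap.contDiff.comp contDiff_snd).add
          (hg.of_le one_le_two)
      filter_upwards [eventually_invariance_equation hFf hFg hδ₀ hh1 hh0 hinv, hdφ, hres,
        hfw _ (half_pos hε), hgw _ (half_pos hε)] with z h1 h2 h3 h4 h5
      have hsplit : fderiv ℝ (fun z => h z - φ z) z (A *ᵥ z + f (z, h z)) - B *ᵥ (h z - φ z) =
          (g (z, h z) - g (z, φ z)) - fderiv ℝ φ z (f (z, h z) - f (z, φ z)) -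
          (fderiv ℝ φ z (A *ᵥ z + f (z, φ z)) - B *ᵥ φ z - g (z, φ z)) := by
        rw [fderiv_fun_sub (hh1.differentiable one_ne_zero z) (hφ1.differentiable one_ne_zero z),
          _root_.sub_apply, h1, mulVec_sub]
        simp only [map_add, map_sub]
        abel
      have h6 : ‖fderiv ℝ φ z (f (z, h z) - f (z, φ z))‖ ≤ ‖f (z, h z) - f (z, φ z)‖ :=
        ((fderiv ℝ φ z).le_opNorm _).trans (mul_le_of_le_one_left (norm_nonneg _) h2.le)
      rw [Real.norm_of_nonneg (by positivity : 0 ≤ ‖z‖ ^ p)] at h3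
      have h7 := norm_sub_le ((g (z, h z) - g (z, φ z)) - fderiv ℝ φ z (f (z, h z) - f (z, φ z)))
        (fderiv ℝ φ z (A *ᵥ z + f (z, φ z)) - B *ᵥ φ z - g (z, φ z))
      have h8 := norm_sub_le (g (z, h z) - g (z, φ z))
        (fderiv ℝ φ z (f (z, h z) - f (z, φ z)))
      simp only [hsplit]
      linarith
  refine ⟨hmain, IsBigO.trans (IsBigO.of_bound 1 ?_) hmain⟩
  filter_upwards [hfw 1 one_pos] with z hz
  rwa [add_sub_add_left_eq_sub]
end
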